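/- For every integer k ≥ 2, the abelianization of the fundamental group of the unordered configuration space C_{k+1}^{1,1} is isomorphic to the cyclic group ℤ/2kℤ. -/

import Mathlib

noncomputable section

open Module Submodule

/-- Topology on the projectivization (quotient topology). -/
instance (K V : Type*) [DivisionRing K] [AddCommGroup V] [Module K V] [TopologicalSpace V] :
    TopologicalSpace (Projectivization K V) :=
  inferInstanceAs (TopologicalSpace (Quotient (projectivizationSetoid K V)))

/-- The complex projective space `ℂP^n`. -/
abbrev CP (n : ℕ) := Projectivization ℂ (Fin (n + 1) → ℂ)

/-- `Fconf k i n` is the ordered configuration space `F_k^{i,n}` of `k` pairwise distinct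
points of `ℂP^n` whose projective span has dimension `i` (i.e. the span of representative
vectors has linear dimension `i + 1`). -/
def Fconf (k i n : ℕ) : Set (Fin k → CP n) :=
  {x | Function.Injective x ∧
    finrank ℂ (span ℂ (Set.range fun j => (x j).rep)) = i + 1}

/-- The equivalence relation on `F_k^{i,n}` identifying tuples differing by a
permutation of the coordinates. -/
def permSetoid (k i n : ℕ) : Setoid (Fconf k i n) where
  r x y := ∃ σ : Equiv.Perm (Fin k), (y : Fin k → CP n) = (x : Fin k → CP n) ∘ σ
  iseqv := by
    constructor
    · intro x; exact ⟨Equiv.refl _, rfl⟩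
    · rintro x y ⟨σ, h⟩
      refine ⟨σ.symm, ?_⟩
      funext i
      simp [h]
    · rintro x y z ⟨σ, h⟩ ⟨τ, h'⟩
      exact ⟨τ.trans σ, by rw [h', h]; rfl⟩

/-- `Cconf k i n` is the unordered configuration space `C_k^{i,n} = F_k^{i,n}/Σ_k`. -/
def Cconf (k i n : ℕ) : Type := Quotient (permSetoid k i n)

instance (k i n : ℕ) : TopologicalSpace (Cconf k i n) :=
  inferInstanceAs (TopologicalSpace (Quotient (permSetoid k i n)))

open CategoryTheory Topology

section Holonomy

variable {X : Type*} [TopologicalSpace X] {B : Type*} [CommGroup B]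
variable (F : FundamentalGroupoid X ⥤ SingleObj B)

/-- The value of a functor from the fundamental groupoid to a commutative group on a path. -/
def hol {x y : X} (p : Path x y) : B :=
  F.map (X := .mk x) (Y := .mk y) (Path.Homotopic.Quotient.mk p)

theorem hol_trans {x y z : X} (p : Path x y) (q : Path y z) :
    hol F (p.trans q) = hol F p * hol F q := by
  have h := F.map_comp (X := .mk x) (Y := .mk y) (Z := .mk z)
    (Path.Homotopic.Quotient.mk p) (Path.Homotopic.Quotient.mk q)
  rw [mul_comm]
  exact h

theorem hol_congr {x y : X} {p q : Path x y} (h : p.Homotopic q) : hol F p = hol F q := by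
  unfold hol
  congr 1
  exact Quotient.sound h

theorem hol_cast {x y x' y' : X} (p : Path x y) (hx : x' = x) (hy : y' = y) :
    hol F (p.cast hx hy) = hol F p := by
  subst hx hy
  rfl

variable {K K' : Type*} [TopologicalSpace K] [TopologicalSpace K']

/-- Holonomy between two points of a simply connected space mapping to `X`. -/
def transport [PathConnectedSpace K] (f : C(K, X)) (u v : K) : B :=
  hol F ((PathConnectedSpace.somePath u v).map f.continuous)

theorem hol_map_eq_transport [SimplyConnectedSpace K] (f : C(K, X)) {u v : K} (p : Path u v) :
    hol F (p.map f.continuous) = transport F f u v :=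
  hol_congr F ((SimplyConnectedSpace.paths_homotopic p _).map f)

theorem transport_mul [SimplyConnectedSpace K] (f : C(K, X)) (u v w : K) :
    transport F f u v * transport F f v w = transport F f u w := by
  unfold transport
  rw [← hol_trans, ← Path.map_trans]
  exact hol_map_eq_transport F f _

theorem transport_self [SimplyConnectedSpace K] (f : C(K, X)) (u : K) :
    transport F f u u = 1 := by
  have := transport_mul F f u u u
  simpa using this

theorem transport_symm [SimplyConnectedSpace K] (f : C(K, X)) (u v : K) :
    transport F f v u = (transport F f u v)⁻¹ := by
  rw [eq_inv_iff_mul_eq_one, transport_mul, transport_self]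

theorem transport_comp [SimplyConnectedSpace K] [PathConnectedSpace K'] (f : C(K, X))
    (g : C(K', K)) (u v : K') :
    transport F (f.comp g) u v = transport F f (g u) (g v) := by
  rw [← hol_map_eq_transport F f ((PathConnectedSpace.somePath u v).map g.continuous)]
  rfl

theorem hol_eq_transport_extend {x y : X} (p : Path x y) :
    hol F p = transport F ⟨p.extend, p.continuous_extend⟩ (0 : ℝ) 1 := by
  have h0 : p.extend 0 = x := p.extend_zero
  have h1 : p.extend 1 = y := p.extend_one
  let l : Path (0 : ℝ) 1 := ⟨⟨fun t => t, by fun_prop⟩, by simp, by simp⟩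
  rw [← hol_map_eq_transport F ⟨p.extend, p.continuous_extend⟩ l]
  have : p = (l.map p.continuous_extend).cast h0.symm h1.symm := by
    ext t
    simp [l]
  conv_lhs => rw [this, hol_cast]

/-- A map into the range of an embedding factors through it. -/
theorem exists_lift_of_isEmbedding {f : C(K, X)} (hf : IsEmbedding f) (g : C(K', X))
    (hg : ∀ j, g j ∈ Set.range f) : ∃ l : C(K', K), f.comp l = g := by
  choose l hl using hg
  refine ⟨⟨l, hf.continuous_iff.mpr ?_⟩, ?_⟩
  · convert g.continuous using 1
    ext j; exact hl j
  · ext j; exact hl j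

variable {E : Type*} [NormedAddCommGroup E] [NormedSpace ℝ E]

/-- If a space is covered by convex charts with a dense set of good points such that the
holonomy between good points of a chart vanishes, then all holonomy vanishes on loops. -/
theorem hol_loop_eq_one_of_charts (S : Set X)
    (h : ∀ x, ∃ (K : Set E) (f : C(K, X)), Convex ℝ K ∧ IsOpen K ∧ IsOpenEmbedding f ∧
      x ∈ Set.range f ∧ Dense (f ⁻¹' S) ∧
      ∀ (u v : K) (p : Path u v), f u ∈ S → f v ∈ S → hol F (p.map f.continuous) = 1)
    {x : X} (p : Path x x) : hol F p = 1 := by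
  choose K f hconv hopen hemb hx hdense hhol using h
  choose u hu using hx
  have : ∀ x, ContractibleSpace (K x) := fun x => (hconv x).contractibleSpace ⟨_, (u x).2⟩
  have hS : ∀ x, ∃ s : K x, f x s ∈ S := fun x => (hdense x).nonempty_iff.mpr ⟨u x⟩
  choose s hs using hS
  let g : X → B := fun x => transport F (f x) (u x) (s x)
  have key : ∀ a (w : K a), ∀ r : K a, f a r ∈ S → transport F (f a) w r = g (f a w) := by
    intro a w r hr
    set x := f a w with hxw
    have hW : IsOpen ((fun y : K a => f a y) ⁻¹' Set.range (f x)) :=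
      (hemb x).isOpen_range.preimage (f a).continuous
    have hW' : IsOpen (Subtype.val '' ((fun y : K a => f a y) ⁻¹' Set.range (f x))) :=
      (hopen a).isOpenMap_subtype_val _ hW
    obtain ⟨ε, hε, hball⟩ := Metric.isOpen_iff.mp hW' w ⟨w, ⟨u x, hu x⟩, rfl⟩
    have hsub : Metric.ball (w : E) ε ⊆ K a := fun y hy => by
      obtain ⟨z, _, rfl⟩ := hball hy; exact z.2
    let J := Metric.ball (w : E) ε
    let inc : C(J, K a) := ⟨Set.inclusion hsub, continuous_inclusion hsub⟩
    have : ContractibleSpace J :=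
      (convex_ball (w : E) ε).contractibleSpace ⟨w, Metric.mem_ball_self hε⟩
    obtain ⟨l, hl⟩ := exists_lift_of_isEmbedding (hemb x).isEmbedding ((f a).comp inc) (fun j => by
      obtain ⟨z, hz, hzj⟩ := hball j.2
      have : inc j = z := Subtype.ext hzj.symm
      simpa [this] using hz)
    obtain ⟨t, htS, htJ⟩ := (hdense a).inter_open_nonempty (Subtype.val ⁻¹' J)
      (Metric.isOpen_ball.preimage continuous_subtype_val) ⟨w, Metric.mem_ball_self hε⟩
    let w' : J := ⟨w, Metric.mem_ball_self hε⟩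
    let t' : J := ⟨t, htS⟩
    have hl' : ∀ j, f x (l j) = f a (inc j) := fun j => congrArg (fun c : C(J, X) => c j) hl
    have hw : l w' = u x := (hemb x).injective (by rw [hl', hu]; rfl)
    have ht : f x (l t') ∈ S := by rw [hl']; exact htJ
    have e1 : transport F (f a) w t = transport F (f x) (u x) (l t') := by
      rw [← hw, ← transport_comp, hl, transport_comp]
      rfl
    have e2 : transport F (f a) t r = 1 := hhol a _ _ _ htJ hr
    have e3 : transport F (f x) (l t') (s x) = 1 := hhol x _ _ _ ht (hs x)
    rw [← transport_mul F (f a) w t r, e1, e2, ← e3, transport_mul]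
  have key' : ∀ a (w w' : K a), transport F (f a) w w' = g (f a w) * (g (f a w'))⁻¹ := by
    intro a w w'
    rw [← key a w _ (hs a), ← key a w' _ (hs a), ← transport_symm, transport_mul]
  let γ : C(ℝ, X) := ⟨p.extend, p.continuous_extend⟩
  have hG : IsLocallyConstant (fun t : ℝ => transport F γ 0 t * g (γ t)) := by
    rw [IsLocallyConstant.iff_eventually_eq]
    intro t
    obtain ⟨ε, hε, hball⟩ := Metric.isOpen_iff.mp
      ((hemb (γ t)).isOpen_range.preimage γ.continuous) t ⟨u (γ t), hu _⟩
    let J := Metric.ball t ε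
    let inc : C(J, ℝ) := ⟨Subtype.val, continuous_subtype_val⟩
    have : ContractibleSpace J :=
      (convex_ball t ε).contractibleSpace ⟨t, Metric.mem_ball_self hε⟩
    obtain ⟨l, hl⟩ := exists_lift_of_isEmbedding (hemb (γ t)).isEmbedding (γ.comp inc)
      (fun j => hball j.2)
    have hl' : ∀ j, f (γ t) (l j) = γ (inc j) := fun j => congrArg (fun c : C(J, X) => c j) hl
    filter_upwards [Metric.ball_mem_nhds t hε] with r hr
    have : transport F γ t r = g (γ t) * (g (γ r))⁻¹ := by
      have h1 := transport_comp F γ inc ⟨t, Metric.mem_ball_self hε⟩ ⟨r, hr⟩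
      rw [← hl, transport_comp, key', hl', hl'] at h1
      exact h1.symm
    rw [← transport_mul F γ 0 t r, this]
    simp [mul_assoc]
  have h01 := hG.apply_eq_of_isPreconnected isPreconnected_univ
    (Set.mem_univ (0 : ℝ)) (Set.mem_univ 1)
  have g0 : γ 0 = x := p.extend_zero
  have g1 : γ 1 = x := p.extend_one
  simp only [g0, g1, transport_self] at h01
  rw [hol_eq_transport_extend]
  exact (mul_right_cancel h01).symm

end Holonomy

section Functors

variable {X : Type*} [TopologicalSpace X] {B : Type*} [CommGroup B]

/-- A functor to a commutative group from its values on path classes. -/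
def functorOfValues (m : ∀ {x y : FundamentalGroupoid X}, (x ⟶ y) → B)
    (h_one : ∀ x : FundamentalGroupoid X, m (𝟙 x) = 1)
    (h_mul : ∀ {x y z : FundamentalGroupoid X} (p : x ⟶ y) (q : y ⟶ z),
      m (p ≫ q) = m q * m p) :
    FundamentalGroupoid X ⥤ SingleObj B where
  obj _ := SingleObj.star B
  map p := m p
  map_id x := h_one x
  map_comp p q := h_mul p q

/-- Changing a functor to a commutative group by a function on the objects. -/
def gaugeFunctor (F : FundamentalGroupoid X ⥤ SingleObj B) (g : X → B) :
    FundamentalGroupoid X ⥤ SingleObj B :=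
  functorOfValues (fun {x y} p => g x.as * (F.map p : B) * (g y.as)⁻¹)
    (fun x => by
      have h : (F.map (𝟙 x) : B) = 1 := F.map_id x
      rw [h, mul_one, mul_inv_cancel])
    (fun {x y z} p q => by
      have h : (F.map (p ≫ q) : B) = (F.map q : B) * (F.map p : B) := F.map_comp p q
      rw [h]
      generalize (F.map q : B) = s
      generalize (F.map p : B) = t
      rw [mul_comm s t, mul_comm (g y.as * s * _), mul_assoc (g x.as * t), mul_assoc (g y.as),
        inv_mul_cancel_left]
      simp only [mul_assoc])

theorem hol_gaugeFunctor (F : FundamentalGroupoid X ⥤ SingleObj B) (g : X → B) {x y : X}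
    (p : Path x y) : hol (gaugeFunctor F g) p = g x * hol F p * (g y)⁻¹ := rfl

/-- The functor to the abelianized fundamental group determined by a choice of paths from the
base point. -/
def abelianizationFunctor [PathConnectedSpace X] (b : X) :
    FundamentalGroupoid X ⥤ SingleObj (Abelianization (FundamentalGroup X b)) :=
  functorOfValues (fun {x y} p => Abelianization.of (G := FundamentalGroup X b)
    ((Path.Homotopic.Quotient.mk (PathConnectedSpace.somePath b x.as) :
        FundamentalGroupoid.mk b ⟶ x) ≫ p ≫ Groupoid.inv
      (Path.Homotopic.Quotient.mk (PathConnectedSpace.somePath b y.as) :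
        FundamentalGroupoid.mk b ⟶ y)))
    (fun x => by
      rw [Category.id_comp, Groupoid.comp_inv]
      exact map_one _)
    (fun {x y z} p q => by
      rw [← map_mul]
      congr 1
      simp [End.mul_def])

theorem exists_hol_abelianizationFunctor_eq [PathConnectedSpace X] (b : X)
    (a : Abelianization (FundamentalGroup X b)) :
    ∃ p : Path b b, hol (abelianizationFunctor b) p = a := by
  obtain ⟨g, rfl⟩ := QuotientGroup.mk_surjective a
  let c : FundamentalGroupoid.mk b ⟶ FundamentalGroupoid.mk b :=
    Path.Homotopic.Quotient.mk (PathConnectedSpace.somePath b b)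
  obtain ⟨p, hp⟩ := Quotient.exists_rep (Groupoid.inv c ≫ g ≫ c)
  refine ⟨p, ?_⟩
  have : hol (abelianizationFunctor b) p =
      Abelianization.of (G := FundamentalGroup X b) (c ≫ (Groupoid.inv c ≫ g ≫ c) ≫
        Groupoid.inv c) := by
    rw [← hp]; rfl
  rw [this]
  simp
  rfl

/-- A functor to the abelianized fundamental group that is onto on loops and trivial along a
given injective simply connected piece. -/
theorem exists_functor_transport_eq_one [PathConnectedSpace X] (b : X) {K : Type*}
    [TopologicalSpace K] [SimplyConnectedSpace K] (f : C(K, X)) (hf : Function.Injective f) :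
    ∃ F : FundamentalGroupoid X ⥤ SingleObj (Abelianization (FundamentalGroup X b)),
      (∀ a, ∃ p : Path b b, hol F p = a) ∧ ∀ u v, transport F f u v = 1 := by
  classical
  obtain ⟨o⟩ := (inferInstance : Nonempty K)
  let F₀ := abelianizationFunctor b
  let g : X → Abelianization (FundamentalGroup X b) := fun x =>
    if h : ∃ u, f u = x then transport F₀ f o h.choose else 1
  have hg : ∀ u, g (f u) = transport F₀ f o u := by
    intro u
    have h : ∃ v, f v = f u := ⟨u, rfl⟩
    simp only [g, dif_pos h]
    rw [hf h.choose_spec]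
  refine ⟨gaugeFunctor F₀ g, fun a => ?_, fun u v => ?_⟩
  · obtain ⟨p, hp⟩ := exists_hol_abelianizationFunctor_eq b a
    refine ⟨p, ?_⟩
    rw [hol_gaugeFunctor, hp, mul_comm (g b), mul_inv_cancel_right]
  · rw [transport, hol_gaugeFunctor, hg, hg]
    change transport F₀ f o u * transport F₀ f u v * _ = 1
    rw [transport_mul, mul_inv_cancel]

end Functors

section ProjectiveLine

/-- The vectors representing the points of the two standard affine charts of `ℂP^1`. -/
def chartVec (e : Bool) (z : ℂ) : Fin 2 → ℂ := if e then ![1, z] else ![z, 1]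

theorem chartVec_ne_zero (e : Bool) (z : ℂ) : chartVec e z ≠ 0 := by
  intro h
  cases e
  · simpa [chartVec] using congrFun h 1
  · simpa [chartVec] using congrFun h 0

@[fun_prop]
theorem continuous_chartVec (e : Bool) : Continuous (chartVec e) := by
  unfold chartVec
  cases e
  · simp only [Bool.false_eq_true, if_false]; fun_prop
  · simp only [if_true]; fun_prop

/-- The two standard affine charts of `ℂP^1`, around `0` and around `∞`. -/
def chartPt (e : Bool) (z : ℂ) : CP 1 := Projectivization.mk ℂ (chartVec e z) (chartVec_ne_zero e z)

/-- The determinant of a pair of vectors of `ℂ²`. -/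
def wedge (v w : Fin 2 → ℂ) : ℂ := v 0 * w 1 - v 1 * w 0

theorem wedge_smul_left (a : ℂ) (v w : Fin 2 → ℂ) : wedge (a • v) w = a * wedge v w := by
  simp [wedge]; ring

theorem wedge_smul_right (a : ℂ) (v w : Fin 2 → ℂ) : wedge v (a • w) = a * wedge v w := by
  simp [wedge]; ring

theorem continuous_wedge : Continuous fun p : (Fin 2 → ℂ) × (Fin 2 → ℂ) => wedge p.1 p.2 := by
  unfold wedge; fun_prop

theorem mk_eq_mk_iff_wedge {v w : Fin 2 → ℂ} (hv : v ≠ 0) (hw : w ≠ 0) :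
    (Projectivization.mk ℂ v hv : CP 1) = Projectivization.mk ℂ w hw ↔ wedge v w = 0 := by
  rw [Projectivization.mk_eq_mk_iff']
  constructor
  · rintro ⟨a, rfl⟩
    simp [wedge]; ring
  · intro h
    unfold wedge at h
    by_cases h0 : w 0 = 0
    · have h1 : w 1 ≠ 0 := fun h1 => hw (by ext i; fin_cases i <;> simp [h0, h1])
      have hv0 : v 0 = 0 := by
        have : v 0 * w 1 = 0 := by rw [h0] at h; simpa using h
        exact (mul_eq_zero.mp this).resolve_right h1
      refine ⟨v 1 / w 1, ?_⟩
      ext i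
      fin_cases i
      · simp [h0, hv0]
      · simp [h1]
    · refine ⟨v 0 / w 0, ?_⟩
      ext i
      fin_cases i
      · simp [h0]
      · simp only [Fin.mk_one, Pi.smul_apply, smul_eq_mul]
        field_simp
        linear_combination h

theorem continuous_projectivization_mk :
    Continuous fun v : {v : Fin 2 → ℂ // v ≠ 0} => (Projectivization.mk ℂ v.1 v.2 : CP 1) :=
  continuous_quotient_mk'

theorem continuous_chartPt (e : Bool) : Continuous (chartPt e) :=
  continuous_projectivization_mk.comp
    ((continuous_chartVec e).subtype_mk (chartVec_ne_zero e))

theorem chartPt_injective (e : Bool) : Function.Injective (chartPt e) := by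
  intro z w h
  rw [chartPt, chartPt, mk_eq_mk_iff_wedge] at h
  cases e <;> simp [chartVec, wedge] at h
  · linear_combination h
  · linear_combination -h

theorem isOpenMap_chartPt (e : Bool) : IsOpenMap (chartPt e) := by
  intro U hU
  refine (isOpen_coinduced (f := Quotient.mk (projectivizationSetoid ℂ (Fin 2 → ℂ)))).mpr ?_
  have hc (i : Fin 2) : Continuous fun v : {v : Fin 2 → ℂ // v ≠ 0} => v.1 i :=
    (continuous_apply i).comp continuous_subtype_val
  cases e
  · have : IsOpen {v : {v : Fin 2 → ℂ // v ≠ 0} | v.1 1 ≠ 0 ∧ v.1 0 / v.1 1 ∈ U} := by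
      have h1 : IsOpen {v : {v : Fin 2 → ℂ // v ≠ 0} | v.1 1 ≠ 0} :=
        isOpen_ne_fun (hc _) continuous_const
      have h2 : ContinuousOn (fun v : {v : Fin 2 → ℂ // v ≠ 0} => v.1 0 / v.1 1)
          {v | v.1 1 ≠ 0} :=
        ContinuousOn.div (hc _).continuousOn (hc _).continuousOn (fun v hv => hv)
      exact h2.isOpen_inter_preimage h1 hU
    convert this using 1
    ext v
    constructor
    · rintro ⟨z, hz, hzv⟩
      have := (mk_eq_mk_iff_wedge (chartVec_ne_zero false z) v.2).mp hzv
      simp only [chartVec, wedge] at this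
      have hv : v.1 0 = z * v.1 1 := by simp at this; linear_combination -this
      have h1 : v.1 1 ≠ 0 := by
        intro h1
        apply v.2
        ext i; fin_cases i <;> simp [hv, h1]
      exact ⟨h1, by rw [hv, mul_div_cancel_right₀ _ h1]; exact hz⟩
    · rintro ⟨h1, h2⟩
      refine ⟨_, h2, ?_⟩
      apply (mk_eq_mk_iff_wedge (chartVec_ne_zero false _) v.2).mpr
      simp [chartVec, wedge]
      field_simp
      ring
  · have : IsOpen {v : {v : Fin 2 → ℂ // v ≠ 0} | v.1 0 ≠ 0 ∧ v.1 1 / v.1 0 ∈ U} := by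
      have h1 : IsOpen {v : {v : Fin 2 → ℂ // v ≠ 0} | v.1 0 ≠ 0} :=
        isOpen_ne_fun (hc _) continuous_const
      have h2 : ContinuousOn (fun v : {v : Fin 2 → ℂ // v ≠ 0} => v.1 1 / v.1 0)
          {v | v.1 0 ≠ 0} :=
        ContinuousOn.div (hc _).continuousOn (hc _).continuousOn (fun v hv => hv)
      exact h2.isOpen_inter_preimage h1 hU
    convert this using 1
    ext v
    constructor
    · rintro ⟨z, hz, hzv⟩
      have := (mk_eq_mk_iff_wedge (chartVec_ne_zero true z) v.2).mp hzv
      simp only [chartVec, wedge] at this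
      have hv : v.1 1 = z * v.1 0 := by simp at this; linear_combination this
      have h1 : v.1 0 ≠ 0 := by
        intro h1
        apply v.2
        ext i; fin_cases i <;> simp [hv, h1]
      exact ⟨h1, by rw [hv, mul_div_cancel_right₀ _ h1]; exact hz⟩
    · rintro ⟨h1, h2⟩
      refine ⟨_, h2, ?_⟩
      apply (mk_eq_mk_iff_wedge (chartVec_ne_zero true _) v.2).mpr
      simp [chartVec, wedge]
      field_simp
      ring

theorem chartPt_true_eq_iff {u z : ℂ} : chartPt true u = chartPt false z ↔ u * z = 1 := by
  rw [chartPt, chartPt, mk_eq_mk_iff_wedge]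
  simp only [chartVec, wedge]
  constructor <;> intro h <;> simp at h ⊢ <;> linear_combination -h

theorem exists_chartPt_eq (p : CP 1) : (∃ z, p = chartPt false z) ∨ p = chartPt true 0 := by
  induction p using Projectivization.ind with
  | h v hv =>
    by_cases h : v 1 = 0
    · right
      rw [chartPt, mk_eq_mk_iff_wedge]
      simp [chartVec, wedge, h]
    · left
      refine ⟨v 0 / v 1, ?_⟩
      rw [chartPt, mk_eq_mk_iff_wedge]
      simp [chartVec, wedge]
      field_simp
      ring

end ProjectiveLine

section Configurations

variable {N : ℕ} [hN : Fact (2 ≤ N)]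

theorem mem_Fconf_of_injective {x : Fin N → CP 1} (hx : Function.Injective x) :
    x ∈ Fconf N 1 1 := by
  refine ⟨hx, le_antisymm ?_ ?_⟩
  · exact (Submodule.finrank_le _).trans (by simp)
  · let i : Fin N := ⟨0, by have := hN.out; omega⟩
    let j : Fin N := ⟨1, by have := hN.out; omega⟩
    have hij : x i ≠ x j := fun h => by simpa [i, j] using hx h
    have hli : LinearIndependent ℂ ![(x i).rep, (x j).rep] := by
      rw [LinearIndependent.pair_iff' (x i).rep_nonzero]
      intro a ha
      apply hij
      rw [← (x i).mk_rep, ← (x j).mk_rep, Projectivization.mk_eq_mk_iff']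
      have ha0 : a ≠ 0 := fun h0 => (x j).rep_nonzero (by rw [← ha, h0, zero_smul])
      exact ⟨a⁻¹, by rw [← ha, inv_smul_smul₀ ha0]⟩
    have h2 := finrank_span_eq_card hli
    rw [Fintype.card_fin] at h2
    refine h2.ge.trans ?_
    apply Submodule.finrank_mono
    apply Submodule.span_mono
    rintro _ ⟨l, rfl⟩
    fin_cases l
    · exact ⟨i, rfl⟩
    · exact ⟨j, rfl⟩

/-- The unordered configuration underlying an ordered one. -/
def confMk : C({x : Fin N → CP 1 // Function.Injective x}, Cconf N 1 1) where
  toFun x := Quotient.mk (permSetoid N 1 1) ⟨x.1, mem_Fconf_of_injective x.2⟩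
  continuous_toFun :=
    continuous_quotient_mk'.comp (continuous_subtype_val.subtype_mk _)

theorem confMk_eq_iff {x y : {x : Fin N → CP 1 // Function.Injective x}} :
    confMk x = confMk y ↔ ∃ σ : Equiv.Perm (Fin N), y.1 = x.1 ∘ σ :=
  Quotient.eq (r := permSetoid N 1 1)

theorem confMk_surjective : Function.Surjective (confMk (N := N)) := by
  intro c
  obtain ⟨x, rfl⟩ := Quotient.exists_rep c
  exact ⟨⟨x.1, x.2.1⟩, rfl⟩

theorem isOpenMap_confMk : IsOpenMap (confMk (N := N)) := by
  intro U hU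
  refine (isOpen_coinduced (f := Quotient.mk (permSetoid N 1 1))).mpr ?_
  have : Quotient.mk (permSetoid N 1 1) ⁻¹' (confMk '' U) =
      ⋃ σ : Equiv.Perm (Fin N),
        (fun x : Fconf N 1 1 => (⟨x.1 ∘ σ, x.2.1.comp σ.injective⟩ :
          {x : Fin N → CP 1 // Function.Injective x})) ⁻¹' U := by
    ext x
    simp only [Set.mem_preimage, Set.mem_iUnion]
    constructor
    · rintro ⟨y, hy, hyx⟩
      obtain ⟨σ, hσ⟩ := (confMk_eq_iff (x := ⟨x.1, x.2.1⟩) (y := y)).mp hyx.symm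
      exact ⟨σ, by convert hy using 1; exact Subtype.ext hσ.symm⟩
    · rintro ⟨σ, hσ⟩
      exact ⟨_, hσ, ((confMk_eq_iff (x := ⟨x.1, x.2.1⟩)).mpr ⟨σ, rfl⟩).symm⟩
  refine this.symm ▸ isOpen_iUnion fun σ => hU.preimage ?_
  refine Continuous.subtype_mk (continuous_pi fun i => ?_) _
  exact (continuous_apply (σ i)).comp continuous_subtype_val

end Configurations

section Regions

variable {N : ℕ}

theorem injective_chartPt_false {y : Fin N → ℂ} (hy : Function.Injective y) :
    Function.Injective fun j => chartPt ((fun _ => false : Fin N → Bool) j) (y j) :=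
  (chartPt_injective false).comp hy

/-- The ordered affine configurations in which no point lies directly above a point with larger
index. -/
def upRegion (N : ℕ) : Set (Fin N → ℂ) :=
  {y | ∀ j l, j < l → ¬ ((y l).re = (y j).re ∧ (y l).im ≤ (y j).im)}

/-- The ordered affine configurations with increasing real parts. -/
def sortedRegion (N : ℕ) : Set (Fin N → ℂ) := {y | StrictMono fun j => (y j).re}

/-- Ordered affine configurations with distinct real parts. -/
def genericRegion (N : ℕ) : Set (Fin N → ℂ) := {y | Function.Injective fun j => (y j).re}

theorem injective_of_mem_upRegion {y : Fin N → ℂ} (hy : y ∈ upRegion N) :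
    Function.Injective y := by
  intro a b hab
  by_contra hne
  rcases lt_or_gt_of_ne hne with h | h
  · exact hy a b h (by simp [hab])
  · exact hy b a h (by simp [hab])

theorem genericRegion_subset_upRegion : genericRegion N ⊆ upRegion N :=
  fun _ hy _ _ hjl h => hjl.ne' (hy h.1)

theorem sortedRegion_subset_genericRegion : sortedRegion N ⊆ genericRegion N :=
  fun _ hy => hy.injective

theorem comp_mem_genericRegion {y : Fin N → ℂ} (hy : y ∈ genericRegion N)
    (τ : Equiv.Perm (Fin N)) : y ∘ τ ∈ genericRegion N :=
  hy.comp τ.injective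

theorem exists_sorted_comp {y : Fin N → ℂ} (hy : y ∈ genericRegion N) :
    ∃ (z : Fin N → ℂ) (τ : Equiv.Perm (Fin N)), z ∈ sortedRegion N ∧ y = z ∘ τ := by
  refine ⟨y ∘ Tuple.sort (fun j => (y j).re), (Tuple.sort (fun j => (y j).re))⁻¹, ?_, ?_⟩
  · exact (Tuple.monotone_sort (fun j => (y j).re)).strictMono_of_injective
      (hy.comp (Equiv.injective _))
  · ext j; simp

theorem sortedRegion_comp_mem (τ : Equiv.Perm (Fin N)) {y : Fin N → ℂ}
    (hy : y ∈ sortedRegion N) : y ∘ τ ∈ upRegion N :=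
  genericRegion_subset_upRegion
    (comp_mem_genericRegion (sortedRegion_subset_genericRegion hy) τ)

theorem convex_sortedRegion : Convex ℝ (sortedRegion N) := by
  rw [convex_iff_forall_pos]
  intro x hx y hy a b ha hb _ i j hij
  have h1 := hx hij
  have h2 := hy hij
  simp only [Pi.add_apply, Pi.smul_apply, Complex.add_re, Complex.real_smul, Complex.mul_re,
    Complex.ofReal_re, Complex.ofReal_im, zero_mul, sub_zero] at *
  nlinarith

/-- The standard sorted configuration. -/
def basePt (N : ℕ) : Fin N → ℂ := fun j => (j : ℕ)

theorem basePt_mem : basePt N ∈ sortedRegion N := by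
  intro i j hij
  simpa [basePt] using hij

theorem starConvex_upRegion :
    StarConvex ℝ (fun j : Fin N => ((j : ℕ) : ℂ) * Complex.I) (upRegion N) := by
  intro y hy a b ha hb hab j l hjl
  have h := hy j l hjl
  have hjl' : ((j : ℕ) : ℝ) < ((l : ℕ) : ℝ) := by exact_mod_cast hjl
  simp only [Pi.add_apply, Pi.smul_apply, Complex.add_re, Complex.real_smul, Complex.mul_re,
    Complex.ofReal_re, Complex.ofReal_im, zero_mul, sub_zero, Complex.add_im, Complex.mul_im,
    Complex.natCast_re, Complex.natCast_im, Complex.I_re, Complex.I_im, mul_zero, mul_one, add_zero,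
    zero_add]
  rintro ⟨h1, h2⟩
  rcases hb.eq_or_lt with rfl | hb
  · simp at hab; subst hab; linarith
  · have h3 : (y l).re = (y j).re := by simpa [hb.ne'] using h1
    have h4 : (y j).im < (y l).im := by
      by_contra h4
      exact h ⟨h3, not_lt.mp h4⟩
    nlinarith

instance contractibleSpace_upRegion : ContractibleSpace (upRegion N) :=
  starConvex_upRegion.contractibleSpace
    ⟨basePt N, by simpa using sortedRegion_comp_mem 1 (basePt_mem (N := N))⟩

instance contractibleSpace_sortedRegion : ContractibleSpace (sortedRegion N) :=
  convex_sortedRegion.contractibleSpace ⟨_, basePt_mem⟩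

theorem injective_chartPt_of_mem_upRegion (y : Fin N → ℂ) (hy : y ∈ upRegion N) :
    Function.Injective fun j => chartPt ((fun _ => false : Fin N → Bool) j) (y j) :=
  injective_chartPt_false (injective_of_mem_upRegion hy)

theorem injective_chartPt_of_mem_sortedRegion (y : Fin N → ℂ) (hy : y ∈ sortedRegion N) :
    Function.Injective fun j => chartPt ((fun _ => false : Fin N → Bool) j) (y j) :=
  injective_chartPt_false (Function.Injective.of_comp (f := Complex.re) hy.injective)

end Regions

section Charts

variable {N : ℕ} [hN : Fact (2 ≤ N)]

/-- The family of configurations whose `j`-th point has coordinate `y j` in the chart `e j`. -/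
def confOn (e : Fin N → Bool) (K : Set (Fin N → ℂ))
    (hK : ∀ y ∈ K, Function.Injective fun j => chartPt (e j) (y j)) : C(K, Cconf N 1 1) :=
  confMk.comp ⟨fun y => ⟨fun j => chartPt (e j) (y.1 j), hK y.1 y.2⟩,
    (continuous_pi fun j => (continuous_chartPt (e j)).comp
      ((continuous_apply j).comp continuous_subtype_val)).subtype_mk _⟩

theorem confOn_eq_iff {e e' : Fin N → Bool} {K K' : Set (Fin N → ℂ)}
    (hK : ∀ y ∈ K, Function.Injective fun j => chartPt (e j) (y j))
    (hK' : ∀ y ∈ K', Function.Injective fun j => chartPt (e' j) (y j)) (y : K) (y' : K') :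
    confOn e K hK y = confOn e' K' hK' y' ↔
      ∃ σ : Equiv.Perm (Fin N), ∀ j, chartPt (e' j) (y'.1 j) = chartPt (e (σ j)) (y.1 (σ j)) :=
  confMk_eq_iff.trans (exists_congr fun _ => funext_iff)

/-- The configurations of the upper region. -/
def upConf : C(upRegion N, Cconf N 1 1) :=
  confOn (fun _ => false) (upRegion N) injective_chartPt_of_mem_upRegion

/-- The configurations of the sorted region. -/
def sortedConf : C(sortedRegion N, Cconf N 1 1) :=
  confOn (fun _ => false) (sortedRegion N) injective_chartPt_of_mem_sortedRegion

theorem sortedConf_injective : Function.Injective (sortedConf (N := N)) := by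
  intro y y' h
  obtain ⟨σ, hσ⟩ := (confOn_eq_iff injective_chartPt_of_mem_sortedRegion
    injective_chartPt_of_mem_sortedRegion y y').mp h
  have h1 : ∀ j, y'.1 j = y.1 (σ j) := fun j => chartPt_injective false (hσ j)
  have h2 : StrictMono σ := by
    intro a b hab
    have := y'.2 hab
    simp only [h1] at this
    exact (y.2.lt_iff_lt).mp this
  have h3 : ∀ j, σ j = j := by
    intro j
    have := Subsingleton.elim (⟨σ, fun {a b} => h2.le_iff_le⟩ : Fin N ≃o Fin N)
      (OrderIso.refl (Fin N))
    exact congrArg (fun e : Fin N ≃o Fin N => e j) this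
  exact Subtype.ext (funext fun j => by rw [h1, h3])

end Charts

section Kappa

variable {N : ℕ} [hN : Fact (2 ≤ N)] {B : Type*} [CommGroup B]
variable (F : FundamentalGroupoid (Cconf N 1 1) ⥤ SingleObj B)

/-- Two families of relabelled points of the upper region giving the same unordered
configurations have the same transports. -/
theorem transport_upConf_congr {P : Type*} [TopologicalSpace P] [PathConnectedSpace P]
    (g g' : C(P, upRegion N)) (τ : Equiv.Perm (Fin N)) (h : ∀ p, (g' p).1 = (g p).1 ∘ τ) (u v : P) :
    transport F upConf (g u) (g v) = transport F upConf (g' u) (g' v) := by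
  rw [← transport_comp, ← transport_comp]
  congr 1
  ext p
  exact (confOn_eq_iff injective_chartPt_of_mem_upRegion injective_chartPt_of_mem_upRegion _ _).mpr
    ⟨τ, fun j => congrArg _ (congrFun (h p) j)⟩

/-- The holonomy of the positive permutation braid of a permutation. -/
def kappa (τ : Equiv.Perm (Fin N)) : B :=
  transport F upConf ⟨basePt N, by simpa using sortedRegion_comp_mem 1 basePt_mem⟩
    ⟨basePt N ∘ τ, sortedRegion_comp_mem τ basePt_mem⟩

variable {F}

theorem transport_upConf_sorted (hF : ∀ u v, transport F (sortedConf (N := N)) u v = 1)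
    (τ : Equiv.Perm (Fin N)) {y y' : Fin N → ℂ}
    (hy : y ∈ sortedRegion N) (hy' : y' ∈ sortedRegion N) :
    transport F upConf ⟨y ∘ τ, sortedRegion_comp_mem τ hy⟩
      ⟨y' ∘ τ, sortedRegion_comp_mem τ hy'⟩ = 1 := by
  let g : C(sortedRegion N, upRegion N) := ⟨fun y => ⟨y.1 ∘ τ, sortedRegion_comp_mem τ y.2⟩, by
    refine Continuous.subtype_mk (continuous_pi fun j => ?_) _
    exact (continuous_apply (τ j)).comp continuous_subtype_val⟩
  have := transport_comp F upConf g ⟨y, hy⟩ ⟨y', hy'⟩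
  have h2 : upConf.comp g = sortedConf := by
    ext y
    exact (confOn_eq_iff injective_chartPt_of_mem_upRegion injective_chartPt_of_mem_sortedRegion _
      _).mpr ⟨τ⁻¹, fun j => by simp [g]⟩
  rw [h2, hF] at this
  exact this.symm

theorem transport_upConf_comp (hF : ∀ u v, transport F (sortedConf (N := N)) u v = 1)
    (τ τ' : Equiv.Perm (Fin N)) {y y' : Fin N → ℂ}
    (hy : y ∈ sortedRegion N) (hy' : y' ∈ sortedRegion N) {z z' : upRegion N}
    (hz : z.1 = y ∘ τ) (hz' : z'.1 = y' ∘ τ') :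
    transport F upConf z z' = (kappa F τ)⁻¹ * kappa F τ' := by
  obtain rfl : z = ⟨y ∘ τ, sortedRegion_comp_mem τ hy⟩ := Subtype.ext hz
  obtain rfl : z' = ⟨y' ∘ τ', sortedRegion_comp_mem τ' hy'⟩ := Subtype.ext hz'
  rw [kappa, kappa, ← transport_symm, transport_mul,
    ← transport_mul F upConf _ ⟨basePt N ∘ τ, sortedRegion_comp_mem τ basePt_mem⟩,
    transport_upConf_sorted hF τ hy basePt_mem, one_mul,
    ← transport_mul F upConf _ ⟨basePt N ∘ τ', sortedRegion_comp_mem τ' basePt_mem⟩,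
    transport_upConf_sorted hF τ' basePt_mem hy', mul_one]

theorem kappa_one : kappa F (1 : Equiv.Perm (Fin N)) = 1 :=
  transport_self F upConf _

end Kappa

section Crossing

variable {n : ℕ}

/-- The motion exchanging two neighbouring points, the right one passing above. -/
def crossing (i : Fin n) (t : ℝ) : Fin (n + 1) → ℂ := fun j =>
  if j = i.castSucc then ⟨(i : ℕ) + t, 0⟩ else
    if j = i.succ then ⟨(i : ℕ) + 1 - t, 1⟩ else ⟨(j : ℕ), 0⟩

theorem crossing_comp_mem_upRegion (i : Fin n) {t : ℝ} (ht : t ∈ unitInterval)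
    {τ : Equiv.Perm (Fin (n + 1))} (hτ : τ⁻¹ i.castSucc < τ⁻¹ i.succ) :
    crossing i t ∘ τ ∈ upRegion (n + 1) := by
  obtain ⟨ht0, ht1⟩ := ht
  rintro j l hjl ⟨h1, h2⟩
  have hne : τ j ≠ τ l := fun h => hjl.ne (τ.injective h)
  have key : ∀ m : Fin (n + 1), m ≠ i.castSucc → m ≠ i.succ →
      ((m : ℕ) : ℝ) + 1 ≤ (i : ℕ) ∨ ((i : ℕ) : ℝ) + 2 ≤ (m : ℕ) := by
    intro m hm1 hm2
    have h1 : (m : ℕ) ≠ i := fun h => hm1 (Fin.ext h)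
    have h2 : (m : ℕ) ≠ i + 1 := fun h => hm2 (Fin.ext h)
    have h3 : (m : ℕ) + 1 ≤ i ∨ (i : ℕ) + 2 ≤ m := by omega
    exact_mod_cast h3
  have hval : ∀ m m' : Fin (n + 1), m ≠ m' → ((m : ℕ) : ℝ) ≠ (m' : ℕ) := fun m m' h h' =>
    h (Fin.ext (by exact_mod_cast h'))
  have hcs : i.castSucc ≠ i.succ := Fin.castSucc_lt_succ.ne
  simp only [Function.comp_apply, crossing] at h1 h2
  by_cases ha : τ j = i.castSucc
  · have hb' : τ l ≠ i.castSucc := fun h => hne (ha.trans h.symm)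
    by_cases hb : τ l = i.succ
    · simp only [ha, hb, hcs.symm, if_true, if_false] at h2
      norm_num at h2
    · simp only [ha, hb, hb', if_true, if_false] at h1
      rcases key _ hb' hb with h | h <;> linarith
  · by_cases ha' : τ j = i.succ
    · by_cases hb : τ l = i.castSucc
      · rw [← ha', ← hb] at hτ
        simp at hτ
        exact absurd hjl hτ.le.not_gt
      · have hb' : τ l ≠ i.succ := fun h => hne (ha'.trans h.symm)
        simp only [ha', hcs.symm, hb, hb', if_true, if_false] at h1
        rcases key _ hb hb' with h | h <;> linarith
    · by_cases hb : τ l = i.castSucc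
      · simp only [ha, ha', hb, if_true, if_false] at h1
        rcases key _ ha ha' with h | h <;> linarith
      · by_cases hb' : τ l = i.succ
        · simp only [ha, ha', hb', hcs.symm, if_true, if_false] at h1
          rcases key _ ha ha' with h | h <;> linarith
        · simp only [ha, ha', hb, hb', if_false] at h1
          exact hval _ _ hne h1.symm

theorem crossing_zero_mem (i : Fin n) : crossing i 0 ∈ sortedRegion (n + 1) := by
  have : ∀ j, (crossing i 0 j).re = (j : ℕ) := by
    intro j
    simp only [crossing]
    split_ifs with h h' <;> simp [*]
  intro a b hab
  simpa [this] using hab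

theorem crossing_one_mem (i : Fin n) :
    crossing i 1 ∘ Equiv.swap i.castSucc i.succ ∈ sortedRegion (n + 1) := by
  have hcs : i.castSucc ≠ i.succ := Fin.castSucc_lt_succ.ne
  have : ∀ j, ((crossing i 1 ∘ Equiv.swap i.castSucc i.succ) j).re = (j : ℕ) := by
    intro j
    simp only [crossing, Function.comp_apply]
    by_cases h : j = i.castSucc
    · subst h
      simp [hcs.symm]
    · by_cases h' : j = i.succ
      · subst h'
        simp
      · simp [Equiv.swap_apply_of_ne_of_ne h h', h, h']
  intro a b hab
  simp only [this]
  exact_mod_cast hab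

theorem continuous_crossing (i : Fin n) : Continuous (crossing i) := by
  refine continuous_pi fun j => ?_
  unfold crossing
  split_ifs
  · exact (Complex.equivRealProdCLM.symm.continuous.comp
      (f := fun t : ℝ => (((i : ℕ) : ℝ) + t, (0 : ℝ))) (by fun_prop) :)
  · exact (Complex.equivRealProdCLM.symm.continuous.comp
      (f := fun t : ℝ => (((i : ℕ) : ℝ) + 1 - t, (1 : ℝ))) (by fun_prop) :)
  · exact continuous_const

variable [hn : Fact (2 ≤ n + 1)] {B : Type*} [CommGroup B]
variable {F : FundamentalGroupoid (Cconf (n + 1) 1 1) ⥤ SingleObj B}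

theorem kappa_swap_mul (hF : ∀ u v, transport F (sortedConf (N := n + 1)) u v = 1) (i : Fin n)
    {τ : Equiv.Perm (Fin (n + 1))} (hτ : τ⁻¹ i.castSucc < τ⁻¹ i.succ) :
    kappa F (Equiv.swap i.castSucc i.succ * τ) =
      kappa F τ * kappa F (Equiv.swap i.castSucc i.succ) := by
  have hcont (τ : Equiv.Perm (Fin (n + 1))) :
      Continuous fun t : unitInterval => crossing i t ∘ τ :=
    continuous_pi fun j => (continuous_apply (τ j)).comp
      ((continuous_crossing i).comp continuous_subtype_val)
  have h1 : (1 : Equiv.Perm (Fin (n + 1)))⁻¹ i.castSucc <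
      (1 : Equiv.Perm (Fin (n + 1)))⁻¹ i.succ := by
    simp
  have : ContractibleSpace unitInterval :=
    (convex_Icc (0 : ℝ) 1).contractibleSpace ⟨0, by simp⟩
  have := transport_upConf_congr F
    ⟨_, (hcont 1).subtype_mk fun t => crossing_comp_mem_upRegion i t.2 h1⟩
    ⟨_, (hcont τ).subtype_mk fun t => crossing_comp_mem_upRegion i t.2 hτ⟩ τ
    (fun t => rfl) 0 1
  rw [transport_upConf_comp hF 1 (Equiv.swap i.castSucc i.succ) (crossing_zero_mem i)
      (crossing_one_mem i) rfl (by ext; simp),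
    transport_upConf_comp hF τ (Equiv.swap i.castSucc i.succ * τ) (crossing_zero_mem i)
      (crossing_one_mem i) rfl (by ext; simp), kappa_one] at this
  rw [inv_one, one_mul, eq_inv_mul_iff_mul_eq] at this
  exact this.symm

end Crossing

section PermutationBraids

variable {n : ℕ} {B : Type*} [CommGroup B] {κ : Equiv.Perm (Fin (n + 1)) → B}

/-- Multiplicativity along length-increasing multiplication by simple transpositions. -/
def IsBraidLike (κ : Equiv.Perm (Fin (n + 1)) → B) : Prop :=
  κ 1 = 1 ∧ ∀ (i : Fin n) (τ : Equiv.Perm (Fin (n + 1))), τ⁻¹ i.castSucc < τ⁻¹ i.succ →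
    κ (Equiv.swap i.castSucc i.succ * τ) = κ τ * κ (Equiv.swap i.castSucc i.succ)

theorem IsBraidLike.swap_eq_swap (h : IsBraidLike κ) {i j : Fin n} (hij : (j : ℕ) = i + 1) :
    κ (Equiv.swap i.castSucc i.succ) = κ (Equiv.swap j.castSucc j.succ) := by
  have e1 : j.castSucc = i.succ := Fin.ext hij
  set a := i.castSucc with ha
  set b := i.succ with hb
  set c := j.succ with hc
  have va : (a : ℕ) = i := rfl
  have vb : (b : ℕ) = i + 1 := rfl
  have vc : (c : ℕ) = i + 2 := by simp [hc, hij]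
  have hab : a < b := by rw [Fin.lt_def]; omega
  have hbc : b < c := by rw [Fin.lt_def]; omega
  have hac : a < c := hab.trans hbc
  rw [e1]
  have A1 := h.2 i
  have A2 := h.2 j
  rw [e1] at A2
  rw [← ha, ← hb] at A1
  rw [← hc] at A2
  have x1 := A2 (Equiv.swap a b)
    (by rw [Equiv.swap_inv, Equiv.swap_apply_right, Equiv.swap_apply_of_ne_of_ne hac.ne' hbc.ne']
        exact hac)
  have x2 := A1 (Equiv.swap b c * Equiv.swap a b) (by
    rw [mul_inv_rev, Equiv.swap_inv, Equiv.swap_inv, Equiv.Perm.mul_apply, Equiv.Perm.mul_apply,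
      Equiv.swap_apply_of_ne_of_ne hab.ne hac.ne, Equiv.swap_apply_left, Equiv.swap_apply_left,
      Equiv.swap_apply_of_ne_of_ne hac.ne' hbc.ne']
    exact hbc)
  have y1 := A1 (Equiv.swap b c)
    (by rw [Equiv.swap_inv, Equiv.swap_apply_left, Equiv.swap_apply_of_ne_of_ne hab.ne hac.ne]
        exact hac)
  have y2 := A2 (Equiv.swap a b * Equiv.swap b c) (by
    rw [mul_inv_rev, Equiv.swap_inv, Equiv.swap_inv, Equiv.Perm.mul_apply, Equiv.Perm.mul_apply,
      Equiv.swap_apply_right, Equiv.swap_apply_of_ne_of_ne hab.ne hac.ne,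
      Equiv.swap_apply_of_ne_of_ne hac.ne' hbc.ne', Equiv.swap_apply_right]
    exact hab)
  have braid : Equiv.swap a b * (Equiv.swap b c * Equiv.swap a b) =
      Equiv.swap b c * (Equiv.swap a b * Equiv.swap b c) := by
    rw [← mul_assoc, ← mul_assoc, Equiv.swap_mul_swap_mul_swap hab.ne hac.ne,
      Equiv.swap_comm a b, Equiv.swap_comm b c,
      Equiv.swap_mul_swap_mul_swap hbc.ne' hac.ne', Equiv.swap_comm]
  rw [x1] at x2
  rw [y1] at y2
  rw [braid, y2] at x2
  have x3 : κ (Equiv.swap b c) * (κ (Equiv.swap a b) * κ (Equiv.swap b c)) =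
      κ (Equiv.swap a b) * (κ (Equiv.swap a b) * κ (Equiv.swap b c)) := by
    rw [← mul_assoc, x2, mul_assoc, mul_comm (κ (Equiv.swap b c))]
  exact (mul_right_cancel x3).symm

theorem IsBraidLike.exists_swap_eq [NeZero n] (h : IsBraidLike κ) (i : Fin n) :
    κ (Equiv.swap i.castSucc i.succ) = κ (Equiv.swap (0 : Fin n).castSucc (0 : Fin n).succ) := by
  obtain ⟨m, hm⟩ := i
  induction m with
  | zero => rfl
  | succ m ih => rw [← ih (by omega)]; exact (h.swap_eq_swap rfl).symm

theorem IsBraidLike.mem_zpowers (h : IsBraidLike κ) {s : B}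
    (hs : ∀ i : Fin n, κ (Equiv.swap i.castSucc i.succ) = s) (τ : Equiv.Perm (Fin (n + 1))) :
    κ τ ∈ Subgroup.zpowers s := by
  have hτ : τ ∈ Submonoid.closure
      (Set.range fun i : Fin n => Equiv.swap i.castSucc i.succ) := by
    rw [Equiv.Perm.mclosure_swap_castSucc_succ]; trivial
  induction hτ using Submonoid.closure_induction_left with
  | one => rw [h.1]; exact one_mem _
  | mul_left x hx τ _ ih =>
    obtain ⟨i, rfl⟩ := hx
    rcases lt_or_gt_of_ne (a := τ⁻¹ i.castSucc) (b := τ⁻¹ i.succ)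
      (fun h => Fin.castSucc_lt_succ.ne (τ⁻¹.injective h)) with hlt | hlt
    · rw [h.2 i τ hlt, hs]
      exact mul_mem ih (Subgroup.mem_zpowers s)
    · have := h.2 i (Equiv.swap i.castSucc i.succ * τ) (by simpa using hlt)
      rw [← mul_assoc, Equiv.swap_mul_self, one_mul, hs] at this
      rw [← mul_inv_eq_of_eq_mul this]
      exact mul_mem ih (inv_mem (Subgroup.mem_zpowers s))

theorem IsBraidLike.finRotate_symm (h : IsBraidLike κ) {s : B}
    (hs : ∀ i : Fin n, κ (Equiv.swap i.castSucc i.succ) = s) :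
    κ (finRotate (n + 1))⁻¹ = s ^ n := by
  have key : ∀ m ≤ n, ∃ τ : Equiv.Perm (Fin (n + 1)), κ τ = s ^ m ∧
      ∀ j, (τ j : ℕ) = if j = 0 then m else if (j : ℕ) ≤ m then (j : ℕ) - 1 else j := by
    intro m
    induction m with
    | zero =>
      refine fun _ => ⟨1, by simpa using h.1, fun j => ?_⟩
      split_ifs with h1 h2
      · simp [h1]
      · simp_all
      · rfl
    | succ m ih =>
      intro hm
      obtain ⟨τ, h1, h2⟩ := ih (by omega)
      let i : Fin n := ⟨m, by omega⟩
      have e0 : τ 0 = i.castSucc := Fin.ext (by simp [h2, i])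
      have e1 : τ⁻¹ i.castSucc = 0 := by rw [Equiv.Perm.inv_eq_iff_eq, e0]
      have e2 : (0 : Fin (n + 1)) < τ⁻¹ i.succ := by
        rw [Fin.pos_iff_ne_zero, Ne, Equiv.Perm.inv_eq_iff_eq, e0]
        exact Fin.castSucc_lt_succ.ne'
      refine ⟨Equiv.swap i.castSucc i.succ * τ, ?_, fun j => ?_⟩
      · rw [h.2 i τ (by rw [e1]; exact e2), h1, hs, pow_succ]
      · by_cases hj : j = 0
        · simp [hj, e0, i]
        · have hj0 : (j : ℕ) ≠ 0 := fun h => hj (Fin.ext h)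
          have ht := h2 j
          rw [if_neg hj] at ht
          rw [if_neg hj, Equiv.Perm.mul_apply]
          by_cases hjm : (j : ℕ) = m + 1
          · have : τ j = i.succ := Fin.ext (by rw [ht]; simp [hjm, i])
            rw [this, Equiv.swap_apply_right]
            simp [i, hjm]
          · rw [Equiv.swap_apply_of_ne_of_ne, ht]
            · split_ifs <;> omega
            · intro hh; have := congrArg Fin.val hh; rw [ht] at this
              simp [i] at this; split_ifs at this <;> omega
            · intro hh; have := congrArg Fin.val hh; rw [ht] at this
              simp [i] at this; split_ifs at this <;> omega
  obtain ⟨τ, h1, h2⟩ := key n le_rfl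
  rw [← h1]
  congr 1
  rw [inv_eq_iff_mul_eq_one]
  ext j
  rw [Equiv.Perm.mul_apply, coe_finRotate]
  have := h2 j
  have hj := j.2
  by_cases hj0 : j = 0
  · simp [hj0] at this ⊢
    exact Fin.ext this
  · have hj0' : (j : ℕ) ≠ 0 := fun h => hj0 (Fin.ext h)
    rw [if_neg hj0, if_pos (by omega)] at this
    rw [if_neg, this]
    · simp; omega
    · intro h'; rw [h'] at this; simp at this; omega

theorem IsBraidLike.finRotate (h : IsBraidLike κ) {s : B}
    (hs : ∀ i : Fin n, κ (Equiv.swap i.castSucc i.succ) = s) :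
    κ (finRotate (n + 1)) = s ^ n := by
  have key : ∀ m ≤ n, ∃ τ : Equiv.Perm (Fin (n + 1)), κ τ = s ^ m ∧
      ∀ j, (τ j : ℕ) = if j = Fin.last n then n - m else
        if n - m ≤ (j : ℕ) then (j : ℕ) + 1 else j := by
    intro m
    induction m with
    | zero =>
      refine fun _ => ⟨1, by simpa using h.1, fun j => ?_⟩
      have := j.2
      split_ifs with h1 h2
      · simp [h1]
      · exact absurd (Fin.ext (by simp; omega)) h1
      · rfl
    | succ m ih =>
      intro hm
      obtain ⟨τ, h1, h2⟩ := ih (by omega)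
      let i : Fin n := ⟨n - m - 1, by omega⟩
      have e0 : τ (Fin.last n) = i.succ := Fin.ext (by simp [h2, i]; omega)
      have e1 : τ⁻¹ i.succ = Fin.last n := by rw [Equiv.Perm.inv_eq_iff_eq, e0]
      have e2 : τ⁻¹ i.castSucc < Fin.last n := by
        rw [Fin.lt_last_iff_ne_last, Ne, Equiv.Perm.inv_eq_iff_eq, e0]
        exact Fin.castSucc_lt_succ.ne
      refine ⟨Equiv.swap i.castSucc i.succ * τ, ?_, fun j => ?_⟩
      · rw [h.2 i τ (by rw [e1]; exact e2), h1, hs, pow_succ]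
      · by_cases hj : j = Fin.last n
        · simp [hj, e0, i]; omega
        · have hj0 : (j : ℕ) ≠ n := fun h => hj (Fin.ext h)
          have ht := h2 j
          have hjn := j.2
          rw [if_neg hj] at ht
          rw [if_neg hj, Equiv.Perm.mul_apply]
          by_cases hjm : (j : ℕ) = n - m - 1
          · have : τ j = i.castSucc := Fin.ext (by
              rw [ht, if_neg (by omega)]; simp [hjm, i])
            rw [this, Equiv.swap_apply_left, if_pos (by omega)]
            simp [i, hjm]
          · rw [Equiv.swap_apply_of_ne_of_ne, ht]
            · split_ifs <;> omega
            · intro hh; have := congrArg Fin.val hh; rw [ht] at this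
              simp [i] at this; split_ifs at this <;> omega
            · intro hh; have := congrArg Fin.val hh; rw [ht] at this
              simp [i] at this; split_ifs at this <;> omega
  obtain ⟨τ, h1, h2⟩ := key n le_rfl
  rw [← h1]
  congr 1
  ext j
  rw [coe_finRotate, h2]
  simp

end PermutationBraids

theorem isBraidLike_kappa {n : ℕ} [Fact (2 ≤ n + 1)] {B : Type*} [CommGroup B]
    {F : FundamentalGroupoid (Cconf (n + 1) 1 1) ⥤ SingleObj B}
    (hF : ∀ u v, transport F (sortedConf (N := n + 1)) u v = 1) : IsBraidLike (kappa F) :=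
  ⟨kappa_one, fun i _ hτ => kappa_swap_mul hF i hτ⟩

section ChartEmbedding

variable {N : ℕ}

/-- Distinct coordinates of the members of a family of configurations stay separated. -/
def IsSeparated (e : Fin N → Bool) (K : Set (Fin N → ℂ)) : Prop :=
  ∀ y ∈ K, ∀ y' ∈ K, ∀ i j, i ≠ j → chartPt (e i) (y i) ≠ chartPt (e j) (y' j)

theorem IsSeparated.injective {e : Fin N → Bool} {K : Set (Fin N → ℂ)} (h : IsSeparated e K)
    (y : Fin N → ℂ) (hy : y ∈ K) : Function.Injective fun j => chartPt (e j) (y j) := by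
  intro i j hij
  by_contra hne
  exact h y hy y hy i j hne hij

theorem IsSeparated.mono {e : Fin N → Bool} {K K' : Set (Fin N → ℂ)} (h : IsSeparated e K)
    (hK : K' ⊆ K) : IsSeparated e K' :=
  fun y hy y' hy' => h y (hK hy) y' (hK hy')

theorem exists_isSeparated_ball {e : Fin N → Bool} {z : Fin N → ℂ}
    (hz : Function.Injective fun j => chartPt (e j) (z j)) :
    ∃ ε > 0, IsSeparated e (Metric.ball z ε) := by
  have hopen : IsOpen {p : (Fin N → ℂ) × (Fin N → ℂ) | ∀ i j, i ≠ j →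
      wedge (chartVec (e i) (p.1 i)) (chartVec (e j) (p.2 j)) ≠ 0} := by
    simp only [Set.ofPred_forall]
    refine isOpen_iInter_of_finite fun i => isOpen_iInter_of_finite fun j =>
      isOpen_iInter_of_finite fun _ => isOpen_ne_fun ?_ continuous_const
    exact continuous_wedge.comp
      (((continuous_chartVec (e i)).comp ((continuous_apply i).comp continuous_fst)).prodMk
        ((continuous_chartVec (e j)).comp ((continuous_apply j).comp continuous_snd)))
  obtain ⟨ε, hε, hball⟩ := Metric.isOpen_iff.mp hopen (z, z) (by
    intro i j hij h
    exact hij (hz ((mk_eq_mk_iff_wedge _ _).mpr h)))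
  refine ⟨ε, hε, fun y hy y' hy' i j hij h => ?_⟩
  have : (y, y') ∈ Metric.ball (z, z) ε := by
    rw [← ball_prod_same]
    exact ⟨hy, hy'⟩
  exact hball this i j hij ((mk_eq_mk_iff_wedge _ _).mp h)

variable [hN : Fact (2 ≤ N)]

theorem IsSeparated.isOpenEmbedding {e : Fin N → Bool} {K : Set (Fin N → ℂ)}
    (h : IsSeparated e K) (hK : IsOpen K) : IsOpenEmbedding (confOn e K h.injective) := by
  refine .of_continuous_injective_isOpenMap (ContinuousMap.continuous _) ?_ ?_
  · intro y y' hyy'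
    obtain ⟨σ, hσ⟩ := (confOn_eq_iff h.injective h.injective y y').mp hyy'
    refine Subtype.ext (funext fun j => ?_)
    have hj : σ j = j := by
      by_contra hne
      exact h _ y'.2 _ y.2 j (σ j) (Ne.symm hne) (hσ j)
    have := hσ j
    rw [hj] at this
    exact (chartPt_injective _ this).symm
  · refine isOpenMap_confMk.comp ?_
    have h1 : IsOpenMap fun y : Fin N → ℂ => fun j => chartPt (e j) (y j) :=
      IsOpenMap.piMap (fun j => isOpenMap_chartPt (e j)) (by simp)
    exact (h1.comp hK.isOpenMap_subtype_val).subtype_mk fun y => h.injective y.1 y.2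

variable {B : Type*} [CommGroup B] (F : FundamentalGroupoid (Cconf N 1 1) ⥤ SingleObj B)

theorem transport_confOn_eq {e : Fin N → Bool} {K : Set (Fin N → ℂ)}
    (hK : ∀ y ∈ K, Function.Injective fun j => chartPt (e j) (y j)) [SimplyConnectedSpace K]
    {P : Set (Fin N → ℂ)} (hP : IsPathConnected P) (hPK : P ⊆ K)
    (φ : (Fin N → ℂ) → Fin N → ℂ) (hφ : ContinuousOn φ P) (τ : Equiv.Perm (Fin N))
    (hup : ∀ y ∈ P, φ y ∘ τ ∈ upRegion N)
    (h : ∀ y ∈ P, ∀ j, chartPt (e j) (y j) = chartPt false (φ y j)) {u v : Fin N → ℂ}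
    (hu : u ∈ P) (hv : v ∈ P) :
    transport F (confOn e K hK) ⟨u, hPK hu⟩ ⟨v, hPK hv⟩ =
      transport F upConf ⟨φ u ∘ τ, hup u hu⟩ ⟨φ v ∘ τ, hup v hv⟩ := by
  have := isPathConnected_iff_pathConnectedSpace.mp hP
  let inc : C(P, K) := ⟨Set.inclusion hPK, continuous_inclusion hPK⟩
  let g : C(P, upRegion N) := ⟨fun y => ⟨φ y.1 ∘ τ, hup y.1 y.2⟩, by
    refine Continuous.subtype_mk (continuous_pi fun j => ?_) _
    exact (continuous_apply (τ j)).comp hφ.domRestrict⟩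
  have h1 := transport_comp F (confOn e K hK) inc ⟨u, hu⟩ ⟨v, hv⟩
  have h2 := transport_comp F upConf g ⟨u, hu⟩ ⟨v, hv⟩
  have h3 : (confOn e K hK).comp inc = upConf.comp g := by
    ext y
    exact (confOn_eq_iff hK injective_chartPt_of_mem_upRegion _ _).mpr
      ⟨τ, fun j => (h y.1 y.2 (τ j)).symm⟩
  rw [h3] at h1
  exact h1.symm.trans h2

variable {F}

theorem transport_upConf_generic (hF : ∀ u v, transport F (sortedConf (N := N)) u v = 1)
    (hκ : ∀ τ : Equiv.Perm (Fin N), kappa F τ = 1) (y y' : upRegion N)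
    (hy : y.1 ∈ genericRegion N) (hy' : y'.1 ∈ genericRegion N) :
    transport F upConf y y' = 1 := by
  obtain ⟨z, τ, hz, h⟩ := exists_sorted_comp hy
  obtain ⟨z', τ', hz', h'⟩ := exists_sorted_comp hy'
  rw [transport_upConf_comp hF τ τ' hz hz' h h', hκ, hκ, inv_one, one_mul]

end ChartEmbedding

section Infinity

/-- The disc of the points `u` such that `u⁻¹` lies in the half plane at distance `M` from the
origin in the direction `d`. -/
def invHalfPlane (M : ℝ) (d : ℂ) : Set ℂ := Metric.ball (((2 * M)⁻¹ : ℝ) • d) (2 * M)⁻¹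

theorem mem_invHalfPlane_iff {M : ℝ} (hM : 0 < M) {d u : ℂ} (hd : d.re ^ 2 + d.im ^ 2 = 1) :
    u ∈ invHalfPlane M d ↔ M * (u.re ^ 2 + u.im ^ 2) < u.re * d.re + u.im * d.im := by
  have hr : 0 < (2 * M)⁻¹ := by positivity
  set r := (2 * M)⁻¹ with hrdef
  have hMr : M * r = 1 / 2 := by rw [hrdef]; field_simp
  rw [invHalfPlane, Metric.mem_ball, dist_eq_norm, ← hrdef, ← abs_of_pos hr, ← abs_norm,
    ← sq_lt_sq, ← Complex.normSq_eq_norm_sq, Complex.normSq_apply]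
  simp only [abs_of_pos hr, Complex.sub_re, Complex.sub_im, Complex.smul_re, Complex.smul_im,
    smul_eq_mul]
  have key : (u.re - r * d.re) * (u.re - r * d.re) + (u.im - r * d.im) * (u.im - r * d.im) =
      u.re ^ 2 + u.im ^ 2 - 2 * r * (u.re * d.re + u.im * d.im) + r ^ 2 := by
    linear_combination r ^ 2 * hd
  rw [key]
  have h2 : M * (u.re ^ 2 + u.im ^ 2 - 2 * r * (u.re * d.re + u.im * d.im)) =
      M * (u.re ^ 2 + u.im ^ 2) - (u.re * d.re + u.im * d.im) := by
    linear_combination (-2 * (u.re * d.re + u.im * d.im)) * hMr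
  constructor
  · intro h
    have : M * (u.re ^ 2 + u.im ^ 2 - 2 * r * (u.re * d.re + u.im * d.im)) < 0 :=
      mul_neg_of_pos_of_neg hM (by linarith)
    linarith
  · intro h
    have : M * (u.re ^ 2 + u.im ^ 2 - 2 * r * (u.re * d.re + u.im * d.im)) < 0 := by linarith
    have := (pos_iff_neg_of_mul_neg this).mp hM
    linarith

theorem lt_inv_of_mem_invHalfPlane {M : ℝ} (hM : 0 < M) {d u : ℂ}
    (hd : d.re ^ 2 + d.im ^ 2 = 1) (hu : u ∈ invHalfPlane M d) :
    u ≠ 0 ∧ M < (u⁻¹).re * d.re - (u⁻¹).im * d.im := by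
  rw [mem_invHalfPlane_iff hM hd] at hu
  have h0 : u ≠ 0 := by
    rintro rfl
    simp at hu
  refine ⟨h0, ?_⟩
  have hpos : 0 < Complex.normSq u := Complex.normSq_pos.mpr h0
  rw [Complex.inv_re, Complex.inv_im, div_mul_eq_mul_div, div_mul_eq_mul_div, ← sub_div,
    lt_div_iff₀ hpos, Complex.normSq_apply]
  nlinarith

end Infinity

section InfinityChart

theorem isOpen_upRegion (N : ℕ) : IsOpen (upRegion N) := by
  simp only [upRegion, Set.ofPred_forall]
  refine isOpen_iInter_of_finite fun j => isOpen_iInter_of_finite fun l =>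
    isOpen_iInter_of_finite fun _ => ?_
  have hc (m : Fin N) : Continuous fun y : Fin N → ℂ => y m := continuous_apply m
  exact ((isClosed_eq (Complex.continuous_re.comp (hc l)) (Complex.continuous_re.comp (hc j))).inter
    (isClosed_le (Complex.continuous_im.comp (hc l))
      (Complex.continuous_im.comp (hc j)))).isOpen_compl

variable {n : ℕ}

/-- The chart type for configurations whose last point is near infinity. -/
def eInf (n : ℕ) : Fin (n + 1) → Bool := fun j => decide (j = Fin.last n)

@[simp] theorem eInf_last : eInf n (Fin.last n) = true := by simp [eInf]

@[simp] theorem eInf_castSucc (j : Fin n) : eInf n j.castSucc = false := by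
  simp [eInf, Fin.castSucc_ne_last]

/-- Passing to affine coordinates near infinity. -/
def invLast (y : Fin (n + 1) → ℂ) : Fin (n + 1) → ℂ :=
  Function.update y (Fin.last n) (y (Fin.last n))⁻¹

@[simp] theorem invLast_last (y : Fin (n + 1) → ℂ) :
    invLast y (Fin.last n) = (y (Fin.last n))⁻¹ := by simp [invLast]

@[simp] theorem invLast_castSucc (y : Fin (n + 1) → ℂ) (j : Fin n) :
    invLast y j.castSucc = y j.castSucc := by simp [invLast, Fin.castSucc_ne_last]

theorem chartPt_eInf_eq {y : Fin (n + 1) → ℂ} (hy : y (Fin.last n) ≠ 0) (j : Fin (n + 1)) :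
    chartPt (eInf n j) (y j) = chartPt false (invLast y j) := by
  induction j using Fin.lastCases with
  | last => simpa using chartPt_true_eq_iff.mpr (mul_inv_cancel₀ hy)
  | cast j => simp

theorem continuousOn_invLast :
    ContinuousOn (invLast (n := n)) {y | y (Fin.last n) ≠ 0} := by
  refine continuousOn_pi.mpr fun j => ?_
  induction j using Fin.lastCases with
  | last =>
    simp only [invLast_last]
    exact (continuous_apply _).continuousOn.inv₀ fun y hy => hy
  | cast j =>
    simp only [invLast_castSucc]
    exact (continuous_apply _).continuousOn

/-- A polydisc around a configuration whose last point is infinity. -/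
structure IsInfChart (z : Fin (n + 1) → ℂ) (M ε : ℝ) : Prop where
  pos : 0 < M
  rad_pos : 0 < ε
  last : z (Fin.last n) = 0
  separated : IsSeparated (eInf n) (Metric.ball z ε)
  bound : ∀ y ∈ Metric.ball z ε, ∀ j : Fin n,
    |(y j.castSucc).re| < M ∧ |(y j.castSucc).im| < M
  up : ∀ y ∈ Metric.ball z ε, y ∘ Fin.castSucc ∈ upRegion n
  small : 2 * M * ε ≤ 1

theorem injective_eInf {z : Fin (n + 1) → ℂ} (hz : z (Fin.last n) = 0)
    (hup : z ∘ Fin.castSucc ∈ upRegion n) :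
    Function.Injective fun j => chartPt (eInf n j) (z j) := by
  intro i j hij
  induction i using Fin.lastCases with
  | last =>
    induction j using Fin.lastCases with
    | last => rfl
    | cast j =>
      simp only [eInf_last, eInf_castSucc, hz, chartPt_true_eq_iff] at hij
      simp at hij
  | cast i =>
    induction j using Fin.lastCases with
    | last =>
      have hij := hij.symm
      simp only [eInf_last, eInf_castSucc, hz, chartPt_true_eq_iff] at hij
      simp at hij
    | cast j =>
      simp only [eInf_castSucc] at hij
      rw [injective_of_mem_upRegion hup (chartPt_injective false hij)]

theorem exists_isInfChart {z : Fin (n + 1) → ℂ} (hz : z (Fin.last n) = 0)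
    (hup : z ∘ Fin.castSucc ∈ upRegion n) : ∃ M ε, IsInfChart z M ε := by
  obtain ⟨ε₁, hε₁, h1⟩ := exists_isSeparated_ball (injective_eInf hz hup)
  have hopen : IsOpen {y : Fin (n + 1) → ℂ | y ∘ Fin.castSucc ∈ upRegion n} :=
    (isOpen_upRegion n).preimage (continuous_pi fun j => continuous_apply _)
  obtain ⟨ε₂, hε₂, h2⟩ := Metric.isOpen_iff.mp hopen z hup
  have hM : 0 < ‖z‖ + 1 := by positivity
  let ε := min (min ε₁ ε₂) (min 1 (2 * (‖z‖ + 1))⁻¹)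
  have hε : 0 < ε := by positivity
  have hle1 : ε ≤ ε₁ := (min_le_left _ _).trans (min_le_left _ _)
  have hle2 : ε ≤ ε₂ := (min_le_left _ _).trans (min_le_right _ _)
  have hle3 : ε ≤ 1 := (min_le_right _ _).trans (min_le_left _ _)
  have hle4 : ε ≤ (2 * (‖z‖ + 1))⁻¹ := (min_le_right _ _).trans (min_le_right _ _)
  refine ⟨‖z‖ + 1, ε, hM, hε, hz, h1.mono (Metric.ball_subset_ball hle1), ?_,
    fun y hy => h2 (Metric.ball_subset_ball hle2 hy), ?_⟩
  · intro y hy j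
    have hy' : ‖y‖ < ‖z‖ + 1 := by
      have := norm_le_norm_add_norm_sub' y z
      rw [Metric.mem_ball, dist_eq_norm] at hy
      linarith
    have := norm_le_pi_norm y j.castSucc
    exact ⟨(Complex.abs_re_le_norm _).trans_lt (this.trans_lt hy'),
      (Complex.abs_im_le_norm _).trans_lt (this.trans_lt hy')⟩
  · calc 2 * (‖z‖ + 1) * ε ≤ 2 * (‖z‖ + 1) * (2 * (‖z‖ + 1))⁻¹ := by gcongr
      _ = 1 := mul_inv_cancel₀ (by positivity)

/-- The part of a polydisc near infinity where the last point lies in a half plane. -/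
def infPart (z : Fin (n + 1) → ℂ) (M ε : ℝ) (d : ℂ) : Set (Fin (n + 1) → ℂ) :=
  {y | y ∈ Metric.ball z ε ∧ y (Fin.last n) ∈ invHalfPlane M d}

theorem convex_infPart (z : Fin (n + 1) → ℂ) (M ε : ℝ) (d : ℂ) : Convex ℝ (infPart z M ε d) :=
  (convex_ball z ε).inter ((convex_ball _ _).linear_preimage
    (LinearMap.proj (R := ℝ) (φ := fun _ : Fin (n + 1) => ℂ) (Fin.last n)))

theorem IsInfChart.update_mem {z : Fin (n + 1) → ℂ} {M ε : ℝ} (h : IsInfChart z M ε) {u : ℂ}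
    (hu : ‖u‖ < ε) : Function.update z (Fin.last n) u ∈ Metric.ball z ε := by
  rw [Metric.mem_ball, dist_pi_lt_iff h.rad_pos]
  intro j
  induction j using Fin.lastCases with
  | last => simpa [h.last] using hu
  | cast j => simpa [Fin.castSucc_ne_last] using h.rad_pos

/-- The top parts of a polydisc near infinity. -/
def infWide (z : Fin (n + 1) → ℂ) (M ε : ℝ) (d : ℂ) : Set (Fin (n + 1) → ℂ) :=
  infPart z M ε 1 ∪ infPart z M ε d ∪ infPart z M ε (-1)

theorem IsInfChart.isPathConnected_infWide {z : Fin (n + 1) → ℂ} {M ε : ℝ}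
    (h : IsInfChart z M ε) {d : ℂ} (hd : d = Complex.I ∨ d = -Complex.I) :
    IsPathConnected (infWide z M ε d) := by
  have hε := h.rad_pos
  have hM := h.pos
  have hs := h.small
  have hd2 : d.re = 0 ∧ d.im ^ 2 = 1 := by rcases hd with rfl | rfl <;> simp
  have hd1 : d.re ^ 2 + d.im ^ 2 = 1 := by simp [hd2.1, hd2.2]
  have hdn : ‖d‖ = 1 := by rcases hd with rfl | rfl <;> simp
  have hmem : ∀ c : ℝ, c ^ 2 = 1 →
      (infPart z M ε (c : ℂ) ∩ infPart z M ε d).Nonempty := by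
    intro c hc
    have hcn : |c| = 1 := by
      rcases sq_eq_one_iff.mp hc with rfl | rfl <;> simp
    let u : ℂ := ((ε / 4 : ℝ) : ℂ) * (c + d)
    have hre : u.re = ε / 4 * c := by simp [u, hd2.1]
    have him : u.im = ε / 4 * d.im := by simp [u]
    have hun : ‖u‖ < ε := by
      have h1 : ‖(c : ℂ) + d‖ ≤ 2 := (norm_add_le _ _).trans (by
        rw [hdn, Complex.norm_real, Real.norm_eq_abs, hcn]; norm_num)
      have : ‖u‖ = ε / 4 * ‖(c : ℂ) + d‖ := by
        rw [norm_mul, Complex.norm_real, Real.norm_of_nonneg (by positivity)]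
      rw [this]
      nlinarith
    have hsum : M * (u.re ^ 2 + u.im ^ 2) < ε / 4 := by
      have : u.re ^ 2 + u.im ^ 2 = ε ^ 2 / 8 := by
        rw [hre, him, mul_pow, mul_pow, hc, hd2.2]; ring
      rw [this]
      nlinarith
    refine ⟨_, ⟨h.update_mem hun, ?_⟩, ⟨h.update_mem hun, ?_⟩⟩
    · rw [Function.update_self, mem_invHalfPlane_iff hM (by simp [hc])]
      rw [Complex.ofReal_re, Complex.ofReal_im, hre] at *
      nlinarith
    · rw [Function.update_self, mem_invHalfPlane_iff hM hd1, hd2.1, him]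
      rw [him] at hsum
      nlinarith [hd2.2]
  have h1 := hmem 1 (by norm_num)
  have h2 := hmem (-1) (by norm_num)
  norm_num at h1 h2
  have p1 := (convex_infPart z M ε 1).isPathConnected (h1.mono Set.inter_subset_left)
  have p2 := (convex_infPart z M ε (-1)).isPathConnected (h2.mono Set.inter_subset_left)
  have p3 := (convex_infPart z M ε d).isPathConnected (h1.mono Set.inter_subset_right)
  refine (p1.union p3 h1).union p2 (h2.mono ?_)
  rintro y ⟨ha, hb⟩
  exact ⟨Or.inr hb, ha⟩

theorem infWide_subset_ball {z : Fin (n + 1) → ℂ} {M ε : ℝ} {d : ℂ} :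
    infWide z M ε d ⊆ Metric.ball z ε := by
  rintro y ((h | h) | h) <;> exact h.1

theorem IsInfChart.mem_infWide {z : Fin (n + 1) → ℂ} {M ε : ℝ} (h : IsInfChart z M ε)
    {y : Fin (n + 1) → ℂ} (hy : y ∈ Metric.ball z ε) (hy0 : y (Fin.last n) ≠ 0) :
    y ∈ infWide z M ε (-Complex.I) ∨ y ∈ infWide z M ε Complex.I := by
  have hM := h.pos
  set u := y (Fin.last n) with hu
  have hun : ‖u‖ < ε := by
    have := (dist_pi_lt_iff h.rad_pos).mp hy (Fin.last n)
    simpa [h.last] using this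
  have hupos : 0 < ‖u‖ := norm_pos_iff.mpr hy0
  have h1 : 2 * M * ‖u‖ ^ 2 < |u.re| + |u.im| := by
    refine lt_of_lt_of_le ?_ (Complex.norm_le_abs_re_add_abs_im u)
    have : 2 * M * ‖u‖ < 1 := lt_of_lt_of_le (by gcongr) h.small
    nlinarith
  rw [← Complex.normSq_eq_norm_sq, Complex.normSq_apply] at h1
  have key : ∀ d : ℂ, d.re ^ 2 + d.im ^ 2 = 1 →
      M * (u.re ^ 2 + u.im ^ 2) < u.re * d.re + u.im * d.im → y ∈ infPart z M ε d :=
    fun d hd hlt => ⟨hy, (mem_invHalfPlane_iff hM hd).mpr hlt⟩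
  by_cases hre : M * (u.re ^ 2 + u.im ^ 2) < |u.re|
  · rcases abs_cases u.re with ⟨h2, _⟩ | ⟨h2, _⟩
    · exact Or.inl (Or.inl (Or.inl (key _ (by simp) (by simpa [h2] using hre))))
    · exact Or.inl (Or.inr (key _ (by simp) (by simpa [h2] using hre)))
  · have him : M * (u.re ^ 2 + u.im ^ 2) < |u.im| := by nlinarith
    rcases abs_cases u.im with ⟨h2, _⟩ | ⟨h2, _⟩
    · exact Or.inr (Or.inl (Or.inr (key _ (by simp) (by simpa [h2] using him))))
    · exact Or.inl (Or.inl (Or.inr (key _ (by simp) (by simpa [h2] using him))))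

theorem IsInfChart.last_ne_zero {z : Fin (n + 1) → ℂ} {M ε : ℝ} (h : IsInfChart z M ε)
    {d : ℂ} (hd : d = Complex.I ∨ d = -Complex.I) {y : Fin (n + 1) → ℂ}
    (hy : y ∈ infWide z M ε d) : y (Fin.last n) ≠ 0 := by
  have hd1 : d.re ^ 2 + d.im ^ 2 = 1 := by rcases hd with rfl | rfl <;> simp
  rcases hy with (hy | hy) | hy
  · exact (lt_inv_of_mem_invHalfPlane h.pos (by simp) hy.2).1
  · exact (lt_inv_of_mem_invHalfPlane h.pos hd1 hy.2).1
  · exact (lt_inv_of_mem_invHalfPlane h.pos (by simp) hy.2).1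

theorem IsInfChart.invLast_mem_upRegion {z : Fin (n + 1) → ℂ} {M ε : ℝ} (h : IsInfChart z M ε)
    {y : Fin (n + 1) → ℂ} (hy : y ∈ infWide z M ε (-Complex.I)) :
    invLast y ∈ upRegion (n + 1) := by
  have hb := infWide_subset_ball hy
  intro j l hjl
  induction j using Fin.lastCases with
  | last => exact absurd hjl (Fin.le_last l).not_gt
  | cast j =>
    induction l using Fin.lastCases with
    | cast l =>
      simp only [invLast_castSucc]
      exact h.up y hb j l (by simpa using hjl)
    | last =>
      simp only [invLast_castSucc, invLast_last]
      obtain ⟨hre, him⟩ := h.bound y hb j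
      rw [abs_lt] at hre him
      rintro ⟨e1, e2⟩
      rcases hy with (hy | hy) | hy
      · have := (lt_inv_of_mem_invHalfPlane h.pos (by simp) hy.2).2
        simp only [Complex.one_re, Complex.one_im] at this
        linarith
      · have := (lt_inv_of_mem_invHalfPlane h.pos (by simp) hy.2).2
        simp only [Complex.neg_re, Complex.neg_im, Complex.I_re, Complex.I_im] at this
        linarith
      · have := (lt_inv_of_mem_invHalfPlane h.pos (by simp) hy.2).2
        simp only [Complex.neg_re, Complex.neg_im, Complex.one_re, Complex.one_im] at this
        linarith

theorem IsInfChart.invLast_comp_mem_upRegion {z : Fin (n + 1) → ℂ} {M ε : ℝ}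
    (h : IsInfChart z M ε) {y : Fin (n + 1) → ℂ} (hy : y ∈ infWide z M ε Complex.I) :
    invLast y ∘ ((finRotate (n + 1))⁻¹ : Equiv.Perm (Fin (n + 1))) ∈ upRegion (n + 1) := by
  have hb := infWide_subset_ball hy
  intro j l hjl
  obtain ⟨a, rfl⟩ := (finRotate (n + 1)).surjective j
  obtain ⟨b, rfl⟩ := (finRotate (n + 1)).surjective l
  have hinv (c : Fin (n + 1)) : (finRotate (n + 1))⁻¹ (finRotate (n + 1) c) = c :=
    Equiv.symm_apply_apply _ c
  simp only [Function.comp_apply, hinv]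
  rw [Fin.lt_def, coe_finRotate, coe_finRotate] at hjl
  induction b using Fin.lastCases with
  | last => simp at hjl
  | cast b =>
    induction a using Fin.lastCases with
    | cast a =>
      simp only [invLast_castSucc]
      refine h.up y hb a b ?_
      simpa [Fin.castSucc_ne_last] using hjl
    | last =>
      simp only [invLast_castSucc, invLast_last]
      obtain ⟨hre, him⟩ := h.bound y hb b
      rw [abs_lt] at hre him
      rintro ⟨e1, e2⟩
      rcases hy with (hy | hy) | hy
      · have := (lt_inv_of_mem_invHalfPlane h.pos (by simp) hy.2).2
        simp only [Complex.one_re, Complex.one_im] at this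
        linarith
      · have := (lt_inv_of_mem_invHalfPlane h.pos (by simp) hy.2).2
        simp only [Complex.I_re, Complex.I_im] at this
        linarith
      · have := (lt_inv_of_mem_invHalfPlane h.pos (by simp) hy.2).2
        simp only [Complex.neg_re, Complex.neg_im, Complex.one_re, Complex.one_im] at this
        linarith

end InfinityChart

section Density

variable {N n : ℕ}

theorem dense_generic {U : Set (Fin N → ℂ)} (hU : IsOpen U) (hUd : Dense U)
    {φ : (Fin N → ℂ) → Fin N → ℂ} (hφ : ContinuousOn φ U) {I : Set (Fin N)}
    (hI : ∀ i j, i ≠ j → i ∈ I ∨ j ∈ I)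
    (hgood : ∀ i ∈ I, ∀ y ∈ U, ∀ t : ℝ, y + Pi.single i (t : ℂ) ∈ U ∧
      φ (y + Pi.single i (t : ℂ)) = φ y + Pi.single i (t : ℂ)) :
    Dense {y | y ∈ U ∧ φ y ∈ genericRegion N} := by
  let D : Fin N × Fin N → Set (Fin N → ℂ) := fun p =>
    {y | y ∈ U ∧ (p.1 ≠ p.2 → (φ y p.1).re ≠ (φ y p.2).re)}
  have hφi (i : Fin N) : ContinuousOn (fun y => (φ y i).re) U :=
    Complex.continuous_re.comp_continuousOn ((continuous_apply i).comp_continuousOn hφ)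
  have hopen : ∀ p, IsOpen (D p) := by
    intro p
    by_cases hp : p.1 = p.2
    · simpa [D, hp] using hU
    · have := ((hφi p.1).sub (hφi p.2)).isOpen_inter_preimage hU
        (isOpen_compl_singleton (x := (0 : ℝ)))
      convert this using 1
      ext y
      simp [D, hp, sub_eq_zero]
  have main : ∀ i j, i ≠ j → i ∈ I →
      Dense {y | y ∈ U ∧ (φ y i).re ≠ (φ y j).re} := by
    intro i j hij hi
    rw [dense_iff_inter_open]
    intro O hO hOne
    obtain ⟨y, hyO, hyU⟩ := hUd.inter_open_nonempty O hO hOne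
    let l : ℝ → Fin N → ℂ := fun t => y + Pi.single i (t : ℂ)
    have hl : Continuous l := continuous_const.add
      ((continuous_single i).comp Complex.continuous_ofReal)
    obtain ⟨t, ht1, ht2⟩ := (dense_compl_singleton ((φ y j).re - (φ y i).re)).inter_open_nonempty
      (l ⁻¹' O) (hO.preimage hl) ⟨0, by simpa [l] using hyO⟩
    obtain ⟨h1, h2⟩ := hgood i hi y hyU t
    refine ⟨l t, ht1, h1, ?_⟩
    change (φ (y + _) i).re ≠ (φ (y + _) j).re
    rw [h2]
    simp only [Pi.add_apply, Pi.single_eq_same, Pi.single_eq_of_ne hij.symm, Complex.add_re,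
      Complex.ofReal_re, add_zero]
    intro h
    exact ht2 (by simp only [Set.mem_singleton_iff]; linarith)
  have hdense : ∀ p, Dense (D p) := by
    rintro ⟨i, j⟩
    by_cases hp : i = j
    · simpa [D, hp] using hUd
    · rcases hI i j hp with hi | hj
      · simpa [D, hp] using main i j hp hi
      · simpa [D, hp, ne_comm] using main j i (Ne.symm hp) hj
  by_cases hne : Nonempty (Fin N)
  · refine (dense_iInter_of_isOpen hopen hdense).mono ?_
    intro y hy
    rw [Set.mem_iInter] at hy
    refine ⟨(hy (hne.some, hne.some)).1, fun i j hij => ?_⟩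
    by_contra h
    exact (hy (i, j)).2 h hij
  · refine hUd.mono fun y hy => ⟨hy, fun i => absurd ⟨i⟩ hne⟩

theorem dense_genericRegion : Dense (genericRegion N) := by
  have := dense_generic (N := N) isOpen_univ dense_univ (φ := id) continuousOn_id (I := Set.univ)
    (by simp) (by simp)
  simpa using this

theorem dense_invLast_generic :
    Dense {y : Fin (n + 1) → ℂ | y (Fin.last n) ≠ 0 ∧ invLast y ∈ genericRegion (n + 1)} := by
  refine dense_generic (U := {y | y (Fin.last n) ≠ 0}) ?_ ?_ continuousOn_invLast
    (I := {i | i ≠ Fin.last n}) ?_ ?_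
  · exact isOpen_ne_fun (continuous_apply _) continuous_const
  · exact (dense_compl_singleton (0 : ℂ)).preimage (isOpenMap_eval (Fin.last n))
  · intro i j hij
    by_contra! h
    simp only [Set.mem_ofPred_eq, not_not] at h
    exact hij (h.1.trans h.2.symm)
  · intro i hi y hy t
    have hi : Fin.last n ≠ i := Ne.symm hi
    have hl : (y + Pi.single i (t : ℂ) : Fin (n + 1) → ℂ) (Fin.last n) = y (Fin.last n) := by
      rw [Pi.add_apply, Pi.single_eq_of_ne hi, add_zero]
    refine ⟨by
      change (y + Pi.single i (t : ℂ) : Fin (n + 1) → ℂ) (Fin.last n) ≠ 0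
      rw [hl]
      exact hy, ?_⟩
    ext j
    induction j using Fin.lastCases with
    | last =>
      rw [invLast_last, hl, Pi.add_apply, invLast_last, Pi.single_eq_of_ne hi, add_zero]
    | cast j => simp

end Density

section InfinitySorted

variable {n : ℕ}

theorem isOpen_infPart (z : Fin (n + 1) → ℂ) (M ε : ℝ) (d : ℂ) : IsOpen (infPart z M ε d) :=
  IsOpen.inter (s := Metric.ball z ε) Metric.isOpen_ball
    (IsOpen.preimage (f := fun y : Fin (n + 1) → ℂ => y (Fin.last n))
      (continuous_apply (Fin.last n)) Metric.isOpen_ball)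

theorem IsInfChart.contractibleSpace {z : Fin (n + 1) → ℂ} {M ε : ℝ} (h : IsInfChart z M ε) :
    ContractibleSpace (Metric.ball z ε) :=
  (convex_ball z ε).contractibleSpace ⟨z, Metric.mem_ball_self h.rad_pos⟩

theorem IsInfChart.invLast_mem_sortedRegion {z : Fin (n + 1) → ℂ} {M ε : ℝ}
    (h : IsInfChart z M ε) {y : Fin (n + 1) → ℂ} (hy : y ∈ infPart z M ε 1)
    (hs : y ∘ Fin.castSucc ∈ sortedRegion n) : invLast y ∈ sortedRegion (n + 1) := by
  intro j l hjl
  induction j using Fin.lastCases with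
  | last => exact absurd hjl (Fin.le_last l).not_gt
  | cast j =>
    induction l using Fin.lastCases with
    | cast l =>
      simp only [invLast_castSucc]
      exact hs (by simpa using hjl)
    | last =>
      simp only [invLast_castSucc, invLast_last]
      have h1 := (abs_lt.mp (h.bound y hy.1 j).1).2
      have h2 := (lt_inv_of_mem_invHalfPlane h.pos (by simp) hy.2).2
      simp only [Complex.one_re, Complex.one_im] at h2
      linarith

theorem IsInfChart.invLast_comp_mem_sortedRegion {z : Fin (n + 1) → ℂ} {M ε : ℝ}
    (h : IsInfChart z M ε) {y : Fin (n + 1) → ℂ} (hy : y ∈ infPart z M ε (-1))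
    (hs : y ∘ Fin.castSucc ∈ sortedRegion n) :
    invLast y ∘ ((finRotate (n + 1))⁻¹ : Equiv.Perm (Fin (n + 1))) ∈ sortedRegion (n + 1) := by
  intro j l hjl
  obtain ⟨a, rfl⟩ := (finRotate (n + 1)).surjective j
  obtain ⟨b, rfl⟩ := (finRotate (n + 1)).surjective l
  have hinv (c : Fin (n + 1)) : (finRotate (n + 1))⁻¹ (finRotate (n + 1) c) = c :=
    Equiv.symm_apply_apply _ c
  simp only [Function.comp_apply, hinv]
  rw [Fin.lt_def, coe_finRotate, coe_finRotate] at hjl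
  induction b using Fin.lastCases with
  | last => simp at hjl
  | cast b =>
    induction a using Fin.lastCases with
    | cast a =>
      simp only [invLast_castSucc]
      refine hs ?_
      simpa [Fin.castSucc_ne_last] using hjl
    | last =>
      simp only [invLast_castSucc, invLast_last]
      have h1 := (abs_lt.mp (h.bound y hy.1 b).1).1
      have h2 := (lt_inv_of_mem_invHalfPlane h.pos (by simp) hy.2).2
      simp only [Complex.neg_re, Complex.neg_im, Complex.one_re, Complex.one_im] at h2
      linarith

end InfinitySorted

section InfinityTransport

variable {n : ℕ} [Fact (2 ≤ n + 1)] {B : Type*} [CommGroup B]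
variable (F : FundamentalGroupoid (Cconf (n + 1) 1 1) ⥤ SingleObj B)

theorem IsInfChart.transport_top {z : Fin (n + 1) → ℂ} {M ε : ℝ} (h : IsInfChart z M ε)
    [SimplyConnectedSpace (Metric.ball z ε)]
    {u v : Fin (n + 1) → ℂ} (hu : u ∈ infWide z M ε (-Complex.I))
    (hv : v ∈ infWide z M ε (-Complex.I)) :
    transport F (confOn (eInf n) (Metric.ball z ε) h.separated.injective)
      ⟨u, infWide_subset_ball hu⟩ ⟨v, infWide_subset_ball hv⟩ =
    transport F upConf ⟨invLast u, h.invLast_mem_upRegion hu⟩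
      ⟨invLast v, h.invLast_mem_upRegion hv⟩ :=
  transport_confOn_eq F h.separated.injective (h.isPathConnected_infWide (Or.inr rfl))
    infWide_subset_ball invLast
    (continuousOn_invLast.mono fun _ hy => h.last_ne_zero (Or.inr rfl) hy) 1
    (fun _ hy => h.invLast_mem_upRegion hy)
    (fun _ hy => chartPt_eInf_eq (h.last_ne_zero (Or.inr rfl) hy)) hu hv

theorem IsInfChart.transport_bottom {z : Fin (n + 1) → ℂ} {M ε : ℝ} (h : IsInfChart z M ε)
    [SimplyConnectedSpace (Metric.ball z ε)]
    {u v : Fin (n + 1) → ℂ} (hu : u ∈ infWide z M ε Complex.I)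
    (hv : v ∈ infWide z M ε Complex.I) :
    transport F (confOn (eInf n) (Metric.ball z ε) h.separated.injective)
      ⟨u, infWide_subset_ball hu⟩ ⟨v, infWide_subset_ball hv⟩ =
    transport F upConf ⟨invLast u ∘ _, h.invLast_comp_mem_upRegion hu⟩
      ⟨invLast v ∘ _, h.invLast_comp_mem_upRegion hv⟩ :=
  transport_confOn_eq F h.separated.injective (h.isPathConnected_infWide (Or.inl rfl))
    infWide_subset_ball invLast
    (continuousOn_invLast.mono fun _ hy => h.last_ne_zero (Or.inl rfl) hy) _
    (fun _ hy => h.invLast_comp_mem_upRegion hy)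
    (fun _ hy => chartPt_eInf_eq (h.last_ne_zero (Or.inl rfl) hy)) hu hv

variable {F}

/-- Dragging a point around all the others gives the sphere relation. -/
theorem pow_eq_one_of_kappa (hF : ∀ u v, transport F (sortedConf (N := n + 1)) u v = 1) {s : B}
    (hs : ∀ i : Fin n, kappa F (Equiv.swap i.castSucc i.succ) = s) : s ^ (2 * n) = 1 := by
  let z : Fin (n + 1) → ℂ := Function.update (basePt (n + 1)) (Fin.last n) 0
  have hupd (u : ℂ) : Function.update z (Fin.last n) u ∘ Fin.castSucc = basePt n := by
    ext j
    simp [z, Fin.castSucc_ne_last, basePt]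
  have hz : z ∘ Fin.castSucc = basePt n := by
    ext j
    simp [z, Fin.castSucc_ne_last, basePt]
  obtain ⟨M, ε, h⟩ := exists_isInfChart (z := z) (by simp [z]) (by
    rw [hz]
    exact genericRegion_subset_upRegion (sortedRegion_subset_genericRegion basePt_mem))
  have hε := h.rad_pos
  have hM := h.pos
  have hsm := h.small
  have := h.contractibleSpace
  have hmem (c : ℝ) (hc : c ^ 2 = 1) :
      Function.update z (Fin.last n) ((ε / 4 * c : ℝ) : ℂ) ∈ infPart z M ε (c : ℂ) := by
    have hcn : |c| = 1 := by rcases sq_eq_one_iff.mp hc with rfl | rfl <;> simp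
    refine ⟨h.update_mem ?_, ?_⟩
    · rw [Complex.norm_real, Real.norm_eq_abs, abs_mul, hcn, abs_of_pos (by positivity)]
      linarith
    · rw [Function.update_self, mem_invHalfPlane_iff hM (by simp [hc])]
      simp only [Complex.ofReal_re, Complex.ofReal_im]
      have e1 : ε / 4 * c * c + 0 * 0 = ε / 4 := by linear_combination (ε / 4) * hc
      have e2 : (ε / 4 * c) ^ 2 + 0 ^ 2 = ε ^ 2 / 16 := by linear_combination (ε ^ 2 / 16) * hc
      rw [e1, e2]
      nlinarith
  have hR := hmem 1 (by norm_num)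
  have hL := hmem (-1) (by norm_num)
  norm_num at hR hL
  have sR := h.invLast_mem_sortedRegion hR (by rw [hupd]; exact basePt_mem)
  have sL := h.invLast_comp_mem_sortedRegion hL (by rw [hupd]; exact basePt_mem)
  have t1 := h.transport_top F (Or.inl (Or.inl hR)) (Or.inr hL)
  have t2 := h.transport_bottom F (Or.inl (Or.inl hR)) (Or.inr hL)
  rw [t1, transport_upConf_comp hF 1 (finRotate (n + 1)) sR sL rfl (by ext; simp),
    transport_upConf_comp hF (finRotate (n + 1))⁻¹ 1 sR sL rfl rfl,
    (isBraidLike_kappa hF).finRotate hs, (isBraidLike_kappa hF).finRotate_symm hs, kappa_one,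
    inv_one, one_mul, mul_one] at t2
  rw [two_mul, pow_add]
  nth_rewrite 1 [t2]
  exact inv_mul_cancel _

theorem IsInfChart.transport_eq_one (hF : ∀ u v, transport F (sortedConf (N := n + 1)) u v = 1)
    (hκ : ∀ τ : Equiv.Perm (Fin (n + 1)), kappa F τ = 1)
    {z : Fin (n + 1) → ℂ} {M ε : ℝ} (h : IsInfChart z M ε)
    [SimplyConnectedSpace (Metric.ball z ε)] (u v : Metric.ball z ε)
    (hu0 : u.1 (Fin.last n) ≠ 0) (hu : invLast u.1 ∈ genericRegion (n + 1))
    (hv0 : v.1 (Fin.last n) ≠ 0) (hv : invLast v.1 ∈ genericRegion (n + 1)) :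
    transport F (confOn (eInf n) (Metric.ball z ε) h.separated.injective) u v = 1 := by
  have hne : (infPart z M ε 1).Nonempty := by
    have hε := h.rad_pos
    have hM := h.pos
    have hsm := h.small
    refine ⟨Function.update z (Fin.last n) ((ε / 4 : ℝ) : ℂ), h.update_mem ?_, ?_⟩
    · rw [Complex.norm_real, Real.norm_of_nonneg (by positivity)]
      linarith
    · rw [Function.update_self, mem_invHalfPlane_iff hM (by simp)]
      simp only [Complex.ofReal_re, Complex.ofReal_im, Complex.one_re, Complex.one_im]
      nlinarith
  obtain ⟨c, hc, hc0, hcg⟩ :=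
    dense_invLast_generic.inter_open_nonempty _ (isOpen_infPart z M ε 1) hne
  have key : ∀ w : Metric.ball z ε, w.1 (Fin.last n) ≠ 0 → invLast w.1 ∈ genericRegion (n + 1) →
      transport F (confOn (eInf n) (Metric.ball z ε) h.separated.injective) w ⟨c, hc.1⟩ = 1 := by
    intro w hw0 hw
    rcases h.mem_infWide w.2 hw0 with hw' | hw'
    · rw [h.transport_top F hw' (Or.inl (Or.inl hc))]
      exact transport_upConf_generic hF hκ _ _ hw hcg
    · rw [h.transport_bottom F hw' (Or.inl (Or.inl hc))]
      exact transport_upConf_generic hF hκ _ _ (comp_mem_genericRegion hw _)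
        (comp_mem_genericRegion hcg _)
  rw [← transport_mul _ _ u ⟨c, hc.1⟩ v, transport_symm _ _ v, key u hu0 hu, key v hv0 hv, inv_one,
    one_mul]

end InfinityTransport

section Classification

variable {N n : ℕ}

theorem exists_comp_mem_upRegion {y : Fin N → ℂ} (hy : Function.Injective y) :
    ∃ τ : Equiv.Perm (Fin N), y ∘ τ ∈ upRegion N := by
  let key : Fin N → ℝ ×ₗ ℝ := fun j => toLex ((y j).re, (y j).im)
  have hkey : Function.Injective key := by
    intro i j hij
    have : ((y i).re, (y i).im) = ((y j).re, (y j).im) := toLex.injective hij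
    rw [Prod.mk.injEq] at this
    exact hy (Complex.ext this.1 this.2)
  refine ⟨Tuple.sort key, fun j l hjl h => ?_⟩
  have hlt := (Tuple.monotone_sort key).strictMono_of_injective
    (hkey.comp (Equiv.injective _)) hjl
  rcases Prod.Lex.toLex_lt_toLex.mp hlt with h1 | h1
  · exact h1.ne h.1.symm
  · exact h1.2.not_ge h.2

variable [Fact (2 ≤ n + 1)]

/-- Every configuration is an affine one, or has infinity as its last point. -/
theorem exists_eq_upConf_or (x : Cconf (n + 1) 1 1) :
    (∃ y : upRegion (n + 1), upConf y = x) ∨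
      ∃ z : Fin (n + 1) → ℂ, z (Fin.last n) = 0 ∧ z ∘ Fin.castSucc ∈ upRegion n ∧
        ∀ (K : Set (Fin (n + 1) → ℂ))
          (hK : ∀ y ∈ K, Function.Injective fun j => chartPt (eInf n j) (y j)) (hz : z ∈ K),
          confOn (eInf n) K hK ⟨z, hz⟩ = x := by
  obtain ⟨⟨p, hp⟩, rfl⟩ := confMk_surjective x
  by_cases hinf : ∃ i, p i = chartPt true 0
  · right
    obtain ⟨i, hi⟩ := hinf
    have hex : ∀ j : Fin n, ∃ w, p (Equiv.swap i (Fin.last n) j.castSucc) = chartPt false w := by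
      intro j
      refine (exists_chartPt_eq _).resolve_right fun h => ?_
      have := hp (h.trans hi.symm)
      rw [Equiv.swap_apply_eq_iff, Equiv.swap_apply_left] at this
      exact Fin.castSucc_ne_last j this
    choose w hw using hex
    have hwinj : Function.Injective w := by
      intro a b hab
      have : p (Equiv.swap i (Fin.last n) a.castSucc) =
          p (Equiv.swap i (Fin.last n) b.castSucc) := by
        rw [hw, hw, hab]
      simpa using hp this
    obtain ⟨τ, hτ⟩ := exists_comp_mem_upRegion hwinj
    let f : Fin (n + 1) → Fin (n + 1) := Fin.lastCases (Fin.last n) fun j => (τ j).castSucc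
    have hf : Function.Injective f := by
      intro a b hab
      induction a using Fin.lastCases with
      | last =>
        induction b using Fin.lastCases with
        | last => rfl
        | cast b => exact absurd (by simpa [f] using hab.symm) (Fin.castSucc_ne_last (τ b))
      | cast a =>
        induction b using Fin.lastCases with
        | last => simp [f, Fin.castSucc_ne_last] at hab
        | cast b => simpa [f] using hab
    let φ : Equiv.Perm (Fin (n + 1)) := Equiv.ofBijective f (Finite.injective_iff_bijective.mp hf)
    refine ⟨Fin.lastCases 0 fun j => w (τ j), by simp, ?_, fun K hK hz => ?_⟩
    · convert hτ using 1
      ext j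
      simp
    · refine (confMk_eq_iff.mpr ⟨φ.trans (Equiv.swap i (Fin.last n)), funext fun j => ?_⟩).symm
      change chartPt (eInf n j) _ = p (Equiv.swap i (Fin.last n) (f j))
      induction j using Fin.lastCases with
      | last => simp [f, hi]
      | cast j => simp [f, hw]
  · left
    have hex : ∀ j, ∃ w, p j = chartPt false w := fun j =>
      (exists_chartPt_eq _).resolve_right fun h => hinf ⟨j, h⟩
    choose w hw using hex
    have hwinj : Function.Injective w := by
      intro a b hab
      exact hp (by rw [hw, hw, hab])
    obtain ⟨τ, hτ⟩ := exists_comp_mem_upRegion hwinj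
    refine ⟨⟨_, hτ⟩, (confMk_eq_iff.mpr ⟨τ, funext fun j => ?_⟩).symm⟩
    exact (hw (τ j)).symm

end Classification

section Generation

variable {n : ℕ} [Fact (2 ≤ n + 1)]

/-- The configurations of affine points with distinct real parts. -/
def genericConf (n : ℕ) [Fact (2 ≤ n + 1)] : Set (Cconf (n + 1) 1 1) :=
  {x | ∃ y : upRegion (n + 1), y.1 ∈ genericRegion (n + 1) ∧ upConf y = x}

theorem confOn_mem_genericConf_iff {e : Fin (n + 1) → Bool} {K : Set (Fin (n + 1) → ℂ)}
    (hK : ∀ y ∈ K, Function.Injective fun j => chartPt (e j) (y j)) (u : K)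
    {w : Fin (n + 1) → ℂ} (h : ∀ j, chartPt (e j) (u.1 j) = chartPt false (w j)) :
    confOn e K hK u ∈ genericConf n ↔ w ∈ genericRegion (n + 1) := by
  constructor
  · rintro ⟨y, hy, hyu⟩
    obtain ⟨σ, hσ⟩ := (confOn_eq_iff injective_chartPt_of_mem_upRegion hK y u).mp hyu
    have : w = y.1 ∘ σ := funext fun j => chartPt_injective false ((h j).symm.trans (hσ j))
    rw [this]
    exact comp_mem_genericRegion hy σ
  · intro hw
    refine ⟨⟨w, genericRegion_subset_upRegion hw⟩, hw, ?_⟩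
    exact (confOn_eq_iff injective_chartPt_of_mem_upRegion hK _ u).mpr ⟨1, h⟩

theorem last_ne_zero_of_mem_genericConf {K : Set (Fin (n + 1) → ℂ)}
    (hK : ∀ y ∈ K, Function.Injective fun j => chartPt (eInf n j) (y j)) {u : K}
    (h : confOn (eInf n) K hK u ∈ genericConf n) : u.1 (Fin.last n) ≠ 0 := by
  obtain ⟨y, hy, hyu⟩ := h
  obtain ⟨σ, hσ⟩ := (confOn_eq_iff injective_chartPt_of_mem_upRegion hK y u).mp hyu
  have := hσ (Fin.last n)
  rw [eInf_last, chartPt_true_eq_iff] at this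
  exact left_ne_zero_of_mul_eq_one this

theorem exists_generic_chart (x : Cconf (n + 1) 1 1) :
    ∃ (K : Set (Fin (n + 1) → ℂ)) (f : C(K, Cconf (n + 1) 1 1)), Convex ℝ K ∧ IsOpen K ∧
      IsOpenEmbedding f ∧ x ∈ Set.range f ∧ Dense (f ⁻¹' genericConf n) ∧
      ∀ {B : Type} [CommGroup B] (F : FundamentalGroupoid (Cconf (n + 1) 1 1) ⥤ SingleObj B),
        (∀ u v, transport F (sortedConf (N := n + 1)) u v = 1) →
        (∀ τ : Equiv.Perm (Fin (n + 1)), kappa F τ = 1) →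
        ∀ (u v : K) (p : Path u v), f u ∈ genericConf n → f v ∈ genericConf n →
          hol F (p.map f.continuous) = 1 := by
  rcases exists_eq_upConf_or x with ⟨y, rfl⟩ | ⟨z, hz, hup, hx⟩
  · obtain ⟨ε₁, hε₁, hsep⟩ := exists_isSeparated_ball (e := fun _ => false)
      (injective_chartPt_of_mem_upRegion y.1 y.2)
    obtain ⟨ε₂, hε₂, hopen⟩ := Metric.isOpen_iff.mp (isOpen_upRegion (n + 1)) y.1 y.2
    have hε : 0 < min ε₁ ε₂ := lt_min hε₁ hε₂
    have hs := hsep.mono (Metric.ball_subset_ball (min_le_left ε₁ ε₂))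
    have hsub : Metric.ball y.1 (min ε₁ ε₂) ⊆ upRegion (n + 1) :=
      (Metric.ball_subset_ball (min_le_right ε₁ ε₂)).trans hopen
    have hpc := (convex_ball y.1 (min ε₁ ε₂)).isPathConnected ⟨_, Metric.mem_ball_self hε⟩
    have := (convex_ball y.1 (min ε₁ ε₂)).contractibleSpace ⟨_, Metric.mem_ball_self hε⟩
    have hiff (u : Metric.ball y.1 (min ε₁ ε₂)) :=
      confOn_mem_genericConf_iff hs.injective u (w := u.1) fun _ => rfl
    refine ⟨_, confOn _ _ hs.injective, convex_ball _ _, Metric.isOpen_ball,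
      hs.isOpenEmbedding Metric.isOpen_ball, ⟨⟨y.1, Metric.mem_ball_self hε⟩, rfl⟩, ?_, ?_⟩
    · have := (dense_genericRegion (N := n + 1)).preimage
        (Metric.isOpen_ball (x := y.1) (ε := min ε₁ ε₂)).isOpenMap_subtype_val
      exact this.mono fun u hu => (hiff u).mpr hu
    · intro B _ F hF hκ u v p hu hv
      rw [hol_map_eq_transport]
      refine (transport_confOn_eq F hs.injective hpc subset_rfl id continuousOn_id 1
        (fun _ hy => hsub hy) (fun _ _ _ => rfl) u.2 v.2).trans ?_
      exact transport_upConf_generic hF hκ _ _ ((hiff u).mp hu) ((hiff v).mp hv)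
  · obtain ⟨M, ε, h⟩ := exists_isInfChart hz hup
    have := h.contractibleSpace
    refine ⟨_, confOn _ _ h.separated.injective, convex_ball _ _, Metric.isOpen_ball,
      h.separated.isOpenEmbedding Metric.isOpen_ball,
      ⟨⟨z, Metric.mem_ball_self h.rad_pos⟩, hx _ _ _⟩, ?_, ?_⟩
    · have := (dense_invLast_generic (n := n)).preimage
        (Metric.isOpen_ball (x := z) (ε := ε)).isOpenMap_subtype_val
      exact this.mono fun u hu => (confOn_mem_genericConf_iff h.separated.injective u
        (chartPt_eInf_eq hu.1)).mpr hu.2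
    · intro B _ F hF hκ u v p hu hv
      have hu0 := last_ne_zero_of_mem_genericConf h.separated.injective hu
      have hv0 := last_ne_zero_of_mem_genericConf h.separated.injective hv
      rw [hol_map_eq_transport]
      exact h.transport_eq_one hF hκ u v hu0
        ((confOn_mem_genericConf_iff _ u (chartPt_eInf_eq hu0)).mp hu) hv0
        ((confOn_mem_genericConf_iff _ v (chartPt_eInf_eq hv0)).mp hv)

theorem joined_sortedConf (u v : sortedRegion (n + 1)) : Joined (sortedConf u) (sortedConf v) :=
  (PathConnectedSpace.joined u v).map sortedConf.continuous

instance pathConnectedSpace_Cconf : PathConnectedSpace (Cconf (n + 1) 1 1) := by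
  let b : sortedRegion (n + 1) := ⟨_, basePt_mem⟩
  have key : ∀ x, Joined x (sortedConf b) := by
    intro x
    obtain ⟨K, f, hK, -, -, ⟨u, rfl⟩, hd, -⟩ := exists_generic_chart x
    have := hK.contractibleSpace ⟨u, u.2⟩
    obtain ⟨s, y, hy, hys⟩ := hd.nonempty_iff.mpr ⟨u⟩
    obtain ⟨z, τ, hz, hzy⟩ := exists_sorted_comp hy
    have h1 : sortedConf ⟨z, hz⟩ = f s := by
      rw [← hys]
      exact (confOn_eq_iff injective_chartPt_of_mem_sortedRegion injective_chartPt_of_mem_upRegion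
        ⟨z, hz⟩ y).mpr ⟨τ, fun j => congrArg _ (congrFun hzy j)⟩
    have h2 := (PathConnectedSpace.joined u s).map f.continuous
    rw [← h1] at h2
    exact h2.trans (joined_sortedConf _ _)
  exact ⟨⟨sortedConf b⟩, fun x y => (key x).trans (key y).symm⟩

/-- Composing a groupoid representation with a group homomorphism. -/
def mapFunctor {X : Type*} [TopologicalSpace X] {B B' : Type*} [CommGroup B] [CommGroup B']
    (φ : B →* B') (F : FundamentalGroupoid X ⥤ SingleObj B) :
    FundamentalGroupoid X ⥤ SingleObj B' :=
  F ⋙ φ.toFunctor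

/-- The homology of the configuration space is generated by an element killed by `2 * n`. -/
theorem exists_generator [NeZero n] (b : Cconf (n + 1) 1 1) :
    ∃ s : Abelianization (FundamentalGroup (Cconf (n + 1) 1 1) b),
      s ^ (2 * n) = 1 ∧ ∀ a, a ∈ Subgroup.zpowers s := by
  obtain ⟨F, hsurj, hF⟩ := exists_functor_transport_eq_one b (sortedConf (N := n + 1))
    sortedConf_injective
  let s := kappa F (Equiv.swap (0 : Fin n).castSucc (0 : Fin n).succ)
  have hs : ∀ i : Fin n, kappa F (Equiv.swap i.castSucc i.succ) = s :=
    (isBraidLike_kappa hF).exists_swap_eq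
  refine ⟨s, pow_eq_one_of_kappa hF hs, fun a => ?_⟩
  let π := QuotientGroup.mk' (Subgroup.zpowers s)
  have hF' : ∀ u v, transport (mapFunctor π F) (sortedConf (N := n + 1)) u v = 1 := fun u v =>
    (congrArg π (hF u v)).trans π.map_one
  have hκ' : ∀ τ : Equiv.Perm (Fin (n + 1)), kappa (mapFunctor π F) τ = 1 := fun τ =>
    (QuotientGroup.eq_one_iff _).mpr ((isBraidLike_kappa hF).mem_zpowers hs τ)
  obtain ⟨p, rfl⟩ := hsurj a
  rw [← QuotientGroup.eq_one_iff]
  refine hol_loop_eq_one_of_charts (E := Fin (n + 1) → ℂ) (mapFunctor π F) (genericConf n)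
    (fun x => ?_) p
  obtain ⟨K, f, h1, h2, h3, h4, h5, h6⟩ := exists_generic_chart x
  exact ⟨K, f, h1, h2, h3, h4, h5, h6 (mapFunctor π F) hF' hκ'⟩

end Generation

section Discriminant

variable {N n : ℕ}

/-- The discriminant of the binary form with given linear factors, up to sign. -/
def disc (v : Fin N → Fin 2 → ℂ) : ℂ := ∏ i, ∏ j, if i = j then 1 else wedge (v i) (v j)

/-- The binary form with given linear factors. -/
def formOf (v : Fin N → Fin 2 → ℂ) (w : Fin 2 → ℂ) : ℂ := ∏ j, wedge (v j) w

theorem disc_ne_zero_iff {v : Fin N → Fin 2 → ℂ} :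
    disc v ≠ 0 ↔ ∀ i j, i ≠ j → wedge (v i) (v j) ≠ 0 := by
  simp only [disc, Finset.prod_ne_zero_iff, Finset.mem_univ, true_imp_iff]
  refine forall_congr' fun i => forall_congr' fun j => ?_
  by_cases h : i = j <;> simp [h]

theorem disc_comp (v : Fin N → Fin 2 → ℂ) (σ : Equiv.Perm (Fin N)) : disc (v ∘ σ) = disc v := by
  unfold disc
  rw [← Equiv.prod_comp σ (fun i => ∏ j, if i = j then (1 : ℂ) else wedge (v i) (v j))]
  refine Finset.prod_congr rfl fun i _ => ?_
  rw [← Equiv.prod_comp σ (fun j => if σ i = j then (1 : ℂ) else wedge (v (σ i)) (v j))]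
  simp

theorem formOf_comp (v : Fin N → Fin 2 → ℂ) (σ : Equiv.Perm (Fin N)) :
    formOf (v ∘ σ) = formOf v :=
  funext fun w => Equiv.prod_comp σ fun j => wedge (v j) w

theorem formOf_smul (c : Fin N → ℂ) (v : Fin N → Fin 2 → ℂ) :
    (formOf fun j => c j • v j) = fun w => (∏ j, c j) * formOf v w := by
  funext w
  simp only [formOf, wedge_smul_left, Finset.prod_mul_distrib]

theorem disc_smul (c : Fin (n + 1) → ℂ) (v : Fin (n + 1) → Fin 2 → ℂ) :
    (disc fun j => c j • v j) = (∏ j, c j) ^ (2 * n) * disc v := by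
  have h1 : ∀ i : Fin (n + 1), (∏ j : Fin (n + 1), if i = j then (1 : ℂ) else c i) = c i ^ n := by
    intro i
    rw [Finset.prod_ite, Finset.prod_const_one, one_mul, Finset.prod_const]
    congr 1
    rw [Finset.filter_ne, Finset.card_erase_of_mem (Finset.mem_univ _), Finset.card_univ,
      Fintype.card_fin, Nat.add_sub_cancel]
  have h2 : (∏ i : Fin (n + 1), ∏ j : Fin (n + 1), if i = j then (1 : ℂ) else c j) =
      (∏ j, c j) ^ n := by
    rw [Finset.prod_comm, ← Finset.prod_pow]
    refine Finset.prod_congr rfl fun i _ => ?_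
    simp_rw [← h1 i, eq_comm]
  have h3 : (∏ i : Fin (n + 1), ∏ j : Fin (n + 1), if i = j then (1 : ℂ) else c i) =
      (∏ j, c j) ^ n := by
    simp_rw [h1, Finset.prod_pow]
  rw [two_mul, pow_add]
  nth_rewrite 1 [← h3]
  rw [← h2]
  simp only [disc, ← Finset.prod_mul_distrib]
  refine Finset.prod_congr rfl fun i _ => Finset.prod_congr rfl fun j _ => ?_
  by_cases h : i = j
  · simp [h]
  · simp only [h, if_false, wedge_smul_left, wedge_smul_right]
    ring

theorem continuous_disc : Continuous (disc (N := N)) := by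
  unfold disc
  refine continuous_finsetProd _ fun i _ => continuous_finsetProd _ fun j _ => ?_
  by_cases h : i = j
  · simp only [h, if_true]; exact continuous_const
  · simp only [h, if_false]
    simp only [wedge]
    fun_prop

theorem continuous_formOf : Continuous (formOf (N := N)) := by
  refine continuous_pi fun w => ?_
  unfold formOf
  refine continuous_finsetProd _ fun j _ => ?_
  simp only [wedge]
  fun_prop

theorem exists_formOf_ne_zero {v : Fin N → Fin 2 → ℂ} (hv : ∀ j, v j ≠ 0) :
    ∃ w, formOf v w ≠ 0 := by
  by_contra! h
  let P : Polynomial ℂ := ∏ j, (Polynomial.C (v j 0) - Polynomial.C (v j 1) * Polynomial.X)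
  have hP : P = 0 := Polynomial.funext fun z => by
    have := h ![z, 1]
    simp only [formOf, wedge] at this
    simpa [P, Polynomial.eval_prod] using this
  obtain ⟨j, -, hj⟩ := Finset.prod_eq_zero_iff.mp hP
  refine hv j (funext fun i => ?_)
  fin_cases i
  · simpa using congrArg (Polynomial.coeff · 0) hj
  · simpa using congrArg (Polynomial.coeff · 1) hj

theorem prod_ite_zero (c : ℂ) : (∏ j : Fin (n + 1), if j = 0 then c else 1) = c := by simp

theorem disc_chartVec_ne_zero {e : Fin (n + 1) → Bool} {y : Fin (n + 1) → ℂ}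
    (h : Function.Injective fun j => chartPt (e j) (y j)) :
    disc (fun j => chartVec (e j) (y j)) ≠ 0 :=
  disc_ne_zero_iff.mpr fun _ _ hij hw => hij (h ((mk_eq_mk_iff_wedge _ _).mpr hw))

variable [hN : Fact (2 ≤ N)]

theorem ne_zero_of_disc_ne_zero {v : Fin N → Fin 2 → ℂ} (hv : disc v ≠ 0) (j : Fin N) :
    v j ≠ 0 := by
  have : Nontrivial (Fin N) := Fin.nontrivial_iff_two_le.mpr hN.out
  obtain ⟨i, hi⟩ := exists_ne j
  intro h
  exact disc_ne_zero_iff.mp hv j i hi.symm (by simp [wedge, h])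

/-- The configuration of the roots of a binary form with given linear factors. -/
def vecConf : C({v : Fin N → Fin 2 → ℂ // disc v ≠ 0}, Cconf N 1 1) :=
  confMk.comp ⟨fun v => ⟨fun j => Projectivization.mk ℂ (v.1 j) (ne_zero_of_disc_ne_zero v.2 j), by
    intro i j hij
    by_contra hne
    exact disc_ne_zero_iff.mp v.2 i j hne ((mk_eq_mk_iff_wedge _ _).mp hij)⟩, by
    refine Continuous.subtype_mk (continuous_pi fun j => ?_) _
    have hj : Continuous fun v : {v : Fin N → Fin 2 → ℂ // disc v ≠ 0} =>
        (⟨v.1 j, ne_zero_of_disc_ne_zero v.2 j⟩ : {w : Fin 2 → ℂ // w ≠ 0}) :=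
      Continuous.subtype_mk ((continuous_apply j).comp continuous_subtype_val) _
    exact continuous_projectivization_mk.comp hj⟩

theorem vecConf_eq_iff {v v' : {v : Fin N → Fin 2 → ℂ // disc v ≠ 0}} :
    vecConf v = vecConf v' ↔
      ∃ (σ : Equiv.Perm (Fin N)) (c : Fin N → ℂ), v'.1 = fun j => c j • (v.1 ∘ σ) j := by
  refine confMk_eq_iff.trans (exists_congr fun σ => ?_)
  constructor
  · intro h
    have : ∀ j, ∃ c : ℂ, c • v.1 (σ j) = v'.1 j := fun j =>
      (Projectivization.mk_eq_mk_iff' ℂ _ _ _ _).mp (congrFun h j)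
    choose c hc using this
    exact ⟨c, funext fun j => (hc j).symm⟩
  · rintro ⟨c, hc⟩
    refine funext fun j => (Projectivization.mk_eq_mk_iff' ℂ _ _ _ _).mpr ⟨c j, ?_⟩
    exact (congrFun hc j).symm

end Discriminant

section Cover

variable {n : ℕ} [Fact (2 ≤ n + 1)]

theorem vecConf_smul {v : Fin (n + 1) → Fin 2 → ℂ} (hv : disc v ≠ 0) (c : Fin (n + 1) → ℂ)
    (hcv : (disc fun j => c j • v j) ≠ 0) : vecConf ⟨_, hcv⟩ = vecConf ⟨v, hv⟩ :=
  (vecConf_eq_iff.mpr ⟨1, c, rfl⟩).symm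

/-- The space of binary forms with normalized discriminant. -/
def FormSpace (n : ℕ) [Fact (2 ≤ n + 1)] : Type :=
  {t : Cconf (n + 1) 1 1 × ((Fin 2 → ℂ) → ℂ) //
    ∃ (v : Fin (n + 1) → Fin 2 → ℂ) (hv : disc v = 1),
      t = (vecConf ⟨v, hv ▸ one_ne_zero⟩, formOf v)}

instance : TopologicalSpace (FormSpace n) := instTopologicalSpaceSubtype

/-- The binary form with given linear factors, as a point of the space of forms. -/
def formMk (v : Fin (n + 1) → Fin 2 → ℂ) (hv : disc v = 1) : FormSpace n := ⟨_, v, hv, rfl⟩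

/-- The roots of a binary form. -/
def formRoots (t : FormSpace n) : Cconf (n + 1) 1 1 := t.1.1

theorem exists_formMk_eq (t : FormSpace n) : ∃ v hv, formMk v hv = t := by
  obtain ⟨_, v, hv, rfl⟩ := t
  exact ⟨v, hv, rfl⟩

theorem continuous_formRoots : Continuous (formRoots (n := n)) :=
  continuous_fst.comp continuous_subtype_val

theorem continuous_formMk {Y : Type*} [TopologicalSpace Y] {v : Y → Fin (n + 1) → Fin 2 → ℂ}
    (hv : ∀ y, disc (v y) = 1) (hc : Continuous v) : Continuous fun y => formMk (v y) (hv y) :=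
  Continuous.subtype_mk ((vecConf.continuous.comp (hc.subtype_mk _)).prodMk
    (continuous_formOf.comp hc)) _

theorem formSpace_ext {t t' : FormSpace n} (h : t.1.1 = t'.1.1) (h' : ∀ w, t.1.2 w = t'.1.2 w) :
    t = t' :=
  Subtype.ext (Prod.ext h (funext h'))

theorem exists_confOn_eq (x : Cconf (n + 1) 1 1) :
    ∃ (e : Fin (n + 1) → Bool) (y : Fin (n + 1) → ℂ) (K : Set (Fin (n + 1) → ℂ)) (_ : IsOpen K)
      (hs : IsSeparated e K) (hy : y ∈ K), confOn e K hs.injective ⟨y, hy⟩ = x := by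
  obtain ⟨⟨p, hp⟩, rfl⟩ := confMk_surjective x
  have : ∀ j, ∃ e z, p j = chartPt e z := fun j => by
    rcases exists_chartPt_eq (p j) with ⟨z, hz⟩ | hz
    · exact ⟨_, z, hz⟩
    · exact ⟨_, _, hz⟩
  choose e y hy using this
  have heq : p = fun j => chartPt (e j) (y j) := funext hy
  obtain ⟨ε, hε, hs⟩ := exists_isSeparated_ball (e := e) (z := y) (heq ▸ hp)
  refine ⟨e, y, _, Metric.isOpen_ball, hs, Metric.mem_ball_self hε, ?_⟩
  exact congrArg confMk (Subtype.ext heq.symm)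

instance : SMul (rootsOfUnity (2 * n) ℂ) (FormSpace n) where
  smul ζ t := ⟨(t.1.1, fun w => (ζ : ℂˣ) * t.1.2 w), by
    obtain ⟨_, v, hv, rfl⟩ := t
    have hd : (disc fun j : Fin (n + 1) => (if j = 0 then ((ζ : ℂˣ) : ℂ) else 1) • v j) = 1 := by
      rw [disc_smul, prod_ite_zero, hv, mul_one]
      rw [← Units.val_pow_eq_pow_val, (mem_rootsOfUnity _ _).mp ζ.2, Units.val_one]
    refine ⟨_, hd, Prod.ext ?_ ?_⟩
    · exact (vecConf_smul _ _ _).symm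
    · rw [formOf_smul, prod_ite_zero]⟩

theorem formSpace_smul_snd (ζ : rootsOfUnity (2 * n) ℂ) (t : FormSpace n) (w : Fin 2 → ℂ) :
    (ζ • t).1.2 w = (ζ : ℂˣ) * t.1.2 w := rfl

instance : MulAction (rootsOfUnity (2 * n) ℂ) (FormSpace n) where
  one_smul t := formSpace_ext rfl fun w => by simp [formSpace_smul_snd]
  mul_smul ζ ξ t := formSpace_ext rfl fun w => by simp [formSpace_smul_snd, mul_assoc]

variable [NeZero n]

theorem exists_smul_formMk_eq {v v' : Fin (n + 1) → Fin 2 → ℂ} (hv : disc v = 1)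
    (hv' : disc v' = 1) {σ : Equiv.Perm (Fin (n + 1))} {c : Fin (n + 1) → ℂ}
    (h : v' = fun j => c j • (v ∘ σ) j) :
    ∃ ζ : rootsOfUnity (2 * n) ℂ, ((ζ : ℂˣ) : ℂ) = ∏ j, c j ∧ ζ • formMk v hv = formMk v' hv' := by
  have hpow : (∏ j, c j) ^ (2 * n) = 1 := by
    rw [h, disc_smul, disc_comp, hv, mul_one] at hv'
    exact hv'
  refine ⟨rootsOfUnity.mkOfPowEq _ hpow, rfl, formSpace_ext ?_ fun w => ?_⟩
  · exact vecConf_eq_iff.mpr ⟨σ, c, h⟩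
  · rw [formSpace_smul_snd]
    change _ * formOf v w = formOf v' w
    rw [h, formOf_smul, formOf_comp]
    rfl

theorem formRoots_eq_iff {t t' : FormSpace n} :
    formRoots t = formRoots t' ↔ t ∈ MulAction.orbit (rootsOfUnity (2 * n) ℂ) t' := by
  constructor
  · intro h
    obtain ⟨v, hv, rfl⟩ := exists_formMk_eq t
    obtain ⟨v', hv', rfl⟩ := exists_formMk_eq t'
    obtain ⟨σ, c, hc⟩ := vecConf_eq_iff.mp h.symm
    obtain ⟨ζ, -, hζ⟩ := exists_smul_formMk_eq hv' hv hc
    exact ⟨ζ, hζ⟩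
  · rintro ⟨ζ, rfl⟩
    rfl

theorem exists_disjoint_nhds (t : FormSpace n) :
    ∃ U ∈ 𝓝 t, ∀ ζ : rootsOfUnity (2 * n) ℂ, ((ζ • ·) '' U ∩ U).Nonempty → ζ = 1 := by
  obtain ⟨v, hv, rfl⟩ := exists_formMk_eq t
  obtain ⟨w, hw⟩ := exists_formOf_ne_zero (ne_zero_of_disc_ne_zero (hv ▸ one_ne_zero))
  set a := formOf v w with ha
  have hc : Continuous fun t : FormSpace n => t.1.2 w :=
    (continuous_apply w).comp (continuous_snd.comp continuous_subtype_val)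
  let U : Set (FormSpace n) := {t | ∀ ζ : rootsOfUnity (2 * n) ℂ, ζ ≠ 1 →
    ‖t.1.2 w - a‖ < ‖(ζ : ℂˣ) * t.1.2 w - a‖}
  have hU : IsOpen U := by
    simp only [U, Set.ofPred_forall]
    refine isOpen_iInter_of_finite fun ζ => isOpen_iInter_of_finite fun _ => ?_
    exact isOpen_lt (hc.sub continuous_const).norm
      ((continuous_const.mul hc).sub continuous_const).norm
  refine ⟨U, hU.mem_nhds fun ζ hζ => ?_, ?_⟩
  · change ‖a - a‖ < ‖(ζ : ℂˣ) * a - a‖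
    rw [sub_self, norm_zero, norm_pos_iff, sub_ne_zero]
    intro h
    refine hζ (Subtype.ext (Units.ext ?_))
    simpa using mul_right_cancel₀ hw (h.trans (one_mul a).symm)
  · rintro ζ ⟨_, ⟨t, ht, rfl⟩, ht'⟩
    by_contra hne
    have h1 := ht ζ hne
    have h2 := ht' ζ⁻¹ (inv_ne_one.mpr hne)
    simp only [formSpace_smul_snd, InvMemClass.coe_inv, Units.inv_mul_cancel_left] at h2
    exact lt_asymm h1 h2

theorem isQuotientMap_formRoots : IsQuotientMap (formRoots (n := n)) := by
  have h2n : 2 * n ≠ 0 := by have := NeZero.ne n; omega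
  have key : ∀ x : Cconf (n + 1) 1 1, ∃ t, formRoots t = x ∧
      ∀ U ∈ 𝓝 t, formRoots '' U ∈ 𝓝 x := by
    intro x
    obtain ⟨e, y₀, K, hK, hs, hy₀, rfl⟩ := exists_confOn_eq x
    let d : K → ℂ := fun y => disc fun j => chartVec (e j) (y.1 j)
    have hd0 (y : K) : d y ≠ 0 := disc_chartVec_ne_zero (hs.injective y.1 y.2)
    have hvc : Continuous fun y : K => fun j => chartVec (e j) (y.1 j) :=
      continuous_pi fun j => (continuous_chartVec (e j)).comp
        ((continuous_apply j).comp continuous_subtype_val)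
    have hd : Continuous d := continuous_disc.comp hvc
    let u : K := ⟨y₀, hy₀⟩
    obtain ⟨c₀, hc₀⟩ := IsAlgClosed.exists_pow_nat_eq (d u)⁻¹ (Nat.pos_of_ne_zero h2n)
    let c : K → ℂ := fun y => c₀ * (d u / d y) ^ ((2 * n : ℕ) : ℂ)⁻¹
    have hc (y : K) : c y ^ (2 * n) * d y = 1 := by
      rw [mul_pow, hc₀, Complex.cpow_nat_inv_pow _ h2n]
      have := hd0 u
      have := hd0 y
      field_simp
    have hcont : ContinuousAt c u := by
      refine continuousAt_const.mul (ContinuousAt.cpow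
        (continuousAt_const.div hd.continuousAt (hd0 u)) continuousAt_const ?_)
      rw [div_self (hd0 u)]
      exact Complex.one_mem_slitPlane
    let V : K → Fin (n + 1) → Fin 2 → ℂ := fun y j =>
      (if j = 0 then c y else 1) • chartVec (e j) (y.1 j)
    have hV (y : K) : disc (V y) = 1 := by
      rw [disc_smul, prod_ite_zero]
      exact hc y
    let s : K → FormSpace n := fun y => formMk (V y) (hV y)
    have hsx (y : K) : formRoots (s y) = confOn e K hs.injective y :=
      vecConf_smul (hd0 y) _ _
    have hsc : ContinuousAt s u := by
      have hVc : ContinuousAt V u := by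
        refine continuousAt_pi.mpr fun j => ?_
        have h1 : ContinuousAt (fun y => if j = 0 then c y else (1 : ℂ)) u := by
          by_cases hj : j = 0
          · simpa only [hj, if_true] using hcont
          · simpa only [hj, if_false] using continuousAt_const
        have h2 : ContinuousAt (fun y : K => chartVec (e j) (y.1 j)) u :=
          ((continuous_apply j).comp hvc).continuousAt
        exact h1.smul h2
      have hind : IsInducing fun t : FormSpace n => t.1 := IsEmbedding.subtypeVal.isInducing
      rw [hind.continuousAt_iff]
      refine ContinuousAt.prodMk ?_ (continuous_formOf.continuousAt.comp hVc)
      have : (fun y => formRoots (s y)) = confOn e K hs.injective := funext hsx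
      change ContinuousAt (fun y => formRoots (s y)) u
      rw [this]
      exact (ContinuousMap.continuous _).continuousAt
    refine ⟨s u, hsx u, fun U hU => ?_⟩
    refine Filter.mem_of_superset ((hs.isOpenEmbedding hK).isOpenMap.image_mem_nhds
      (hsc.preimage_mem_nhds hU)) ?_
    rintro _ ⟨y, hy, rfl⟩
    exact ⟨s y, hy, hsx y⟩
  refine (isQuotientMap_iff _).mpr ⟨isCoinducing_iff.mpr fun S =>
    ⟨fun h => isOpen_iff_mem_nhds.mpr fun x hx => ?_,
    fun h => h.preimage continuous_formRoots⟩, fun x => ?_⟩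
  · obtain ⟨t, rfl, ht⟩ := key x
    exact Filter.mem_of_superset (ht _ (h.mem_nhds hx)) (Set.image_preimage_subset _ _)
  · obtain ⟨t, ht, -⟩ := key x
    exact ⟨t, ht⟩

theorem isQuotientCoveringMap_formRoots :
    IsQuotientCoveringMap (formRoots (n := n)) (rootsOfUnity (2 * n) ℂ) where
  __ := isQuotientMap_formRoots
  continuous_const_smul ζ := by
    refine Continuous.subtype_mk (continuous_formRoots.prodMk (continuous_pi fun w => ?_)) _
    exact continuous_const.mul
      ((continuous_apply w).comp (continuous_snd.comp continuous_subtype_val))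
  apply_eq_iff_mem_orbit := formRoots_eq_iff
  disjoint := exists_disjoint_nhds

end Cover

section Rotation

/-- The rotation of the plane with weights `1` and `-1`. -/
def rotVec (θ : ℝ) (w : Fin 2 → ℂ) : Fin 2 → ℂ :=
  ![Complex.exp (θ * Complex.I) * w 0, Complex.exp (-(θ * Complex.I)) * w 1]

theorem wedge_rotVec (θ : ℝ) (w w' : Fin 2 → ℂ) :
    wedge (rotVec θ w) (rotVec θ w') = wedge w w' := by
  have h : Complex.exp (θ * Complex.I) * Complex.exp (-(θ * Complex.I)) = 1 := by
    rw [← Complex.exp_add, add_neg_cancel, Complex.exp_zero]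
  simp only [wedge, rotVec, Matrix.cons_val_zero, Matrix.cons_val_one]
  linear_combination (w 0 * w' 1 - w 1 * w' 0) * h

theorem disc_rotVec {N : ℕ} (θ : ℝ) (v : Fin N → Fin 2 → ℂ) :
    (disc fun j => rotVec θ (v j)) = disc v := by
  simp only [disc, wedge_rotVec]

theorem rotVec_zero (w : Fin 2 → ℂ) : rotVec 0 w = w := by
  funext i
  fin_cases i <;> simp [rotVec]

theorem continuous_rotVec (w : Fin 2 → ℂ) : Continuous fun θ => rotVec θ w := by
  refine continuous_pi fun i => ?_
  fin_cases i
  · exact (by fun_prop : Continuous fun θ : ℝ => Complex.exp (θ * Complex.I) * w 0)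
  · exact (by fun_prop : Continuous fun θ : ℝ => Complex.exp (-(θ * Complex.I)) * w 1)

theorem rotVec_smul_affine (c z : ℂ) (θ : ℝ) :
    rotVec θ (c • ![z, 1]) =
      Complex.exp (-(θ * Complex.I)) • c • ![Complex.exp (2 * (θ * Complex.I)) * z, 1] := by
  have h : Complex.exp (θ * Complex.I) =
      Complex.exp (-(θ * Complex.I)) * Complex.exp (2 * (θ * Complex.I)) := by
    rw [← Complex.exp_add]
    ring_nf
  funext i
  fin_cases i
  · simp only [rotVec, h, Fin.zero_eta, Matrix.cons_val_zero, Pi.smul_apply, smul_eq_mul]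
    ring
  · simp [rotVec]

theorem pow_finRotate {m : ℕ} {ω : ℂ} (hω : ω ^ m = 1) (j : Fin m) :
    ω ^ (finRotate m j : ℕ) = ω * ω ^ (j : ℕ) := by
  cases m with
  | zero => exact j.elim0
  | succ m =>
    rw [finRotate_apply, ← pow_succ', Fin.val_add, Fin.val_one',
      Nat.add_mod_mod, ← pow_eq_pow_mod _ hω]

variable {n : ℕ} [Fact (2 ≤ n + 1)] [NeZero n]

theorem exists_joined_smul {a : Fin (n + 1) → ℂ} (ha : Function.Injective a)
    (σ : Equiv.Perm (Fin (n + 1))) (α : ℝ)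
    (h : ∀ j, Complex.exp (2 * (α * Complex.I)) * a j = a (σ j)) :
    ∃ (t : FormSpace n) (ζ : rootsOfUnity (2 * n) ℂ),
      ((ζ : ℂˣ) : ℂ) = Complex.exp (-(α * Complex.I)) ^ (n + 1) ∧ Joined t (ζ • t) := by
  let u : Fin (n + 1) → Fin 2 → ℂ := fun j => ![a j, 1]
  have hu : disc u ≠ 0 := disc_ne_zero_iff.mpr fun i j hij hw => hij (ha (by
    simpa [u, wedge, sub_eq_zero] using hw))
  have hpos : 0 < (n + 1) * (2 * n) := by have := NeZero.pos n; positivity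
  obtain ⟨c, hc⟩ := IsAlgClosed.exists_pow_nat_eq (disc u)⁻¹ hpos
  let v : Fin (n + 1) → Fin 2 → ℂ := fun j => c • u j
  have hv : disc v = 1 := by
    rw [show v = fun j => (fun _ => c : Fin (n + 1) → ℂ) j • u j from rfl, disc_smul,
      Finset.prod_const, Finset.card_univ, Fintype.card_fin, ← pow_mul, hc, inv_mul_cancel₀ hu]
  have hr (θ : ℝ) : (disc fun j => rotVec θ (v j)) = 1 := (disc_rotVec θ v).trans hv
  have hα : (fun j => rotVec α (v j)) =
      fun j => (fun _ => Complex.exp (-(α * Complex.I)) : Fin (n + 1) → ℂ) j • (v ∘ σ) j := by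
    funext j
    simp only [v, u, rotVec_smul_affine, h, Function.comp_apply]
  obtain ⟨ζ, hζ, hζv⟩ := exists_smul_formMk_eq hv (hr α) hα
  refine ⟨formMk v hv, ζ, by simpa using hζ, ?_⟩
  have hcont : Continuous fun θ : ℝ => formMk (fun j => rotVec θ (v j)) (hr θ) :=
    continuous_formMk hr (continuous_pi fun j => continuous_rotVec (v j))
  have h0 : formMk (fun j => rotVec 0 (v j)) (hr 0) = formMk v hv := by
    congr 1
    exact funext fun j => rotVec_zero (v j)
  rw [hζv, ← h0]
  exact (PathConnectedSpace.joined (0 : ℝ) α).map hcont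

theorem exists_joined_neg_one :
    ∃ (t : FormSpace n) (ζ : rootsOfUnity (2 * n) ℂ), ((ζ : ℂˣ) : ℂ) = -1 ∧ Joined t (ζ • t) := by
  have hω := Complex.isPrimitiveRoot_exp (n + 1) n.succ_ne_zero
  have hn : ((n + 1 : ℕ) : ℂ) ≠ 0 := Nat.cast_ne_zero.mpr n.succ_ne_zero
  obtain ⟨t, ζ, hζ, ht⟩ := exists_joined_smul (n := n)
    (a := fun j => Complex.exp (2 * Real.pi * Complex.I / (n + 1 : ℕ)) ^ (j : ℕ))
    (fun i j hij => Fin.ext (hω.pow_inj i.2 j.2 hij)) (finRotate (n + 1))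
    (Real.pi / (n + 1 : ℕ)) fun j => by
      rw [pow_finRotate hω.pow_eq_one]
      congr 2
      push_cast
      ring
  refine ⟨t, ζ, ?_, ht⟩
  rw [hζ, ← Complex.exp_nat_mul, ← Complex.exp_neg_pi_mul_I]
  congr 1
  push_cast at hn ⊢
  field_simp

theorem exists_joined_exp :
    ∃ (t : FormSpace n) (ζ : rootsOfUnity (2 * n) ℂ),
      ((ζ : ℂˣ) : ℂ) = -Complex.exp (-(Real.pi * Complex.I / n)) ∧ Joined t (ζ • t) := by
  have hω := Complex.isPrimitiveRoot_exp n (NeZero.ne n)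
  have hn : (n : ℂ) ≠ 0 := Nat.cast_ne_zero.mpr (NeZero.ne n)
  obtain ⟨t, ζ, hζ, ht⟩ := exists_joined_smul (n := n)
    (a := Fin.cons 0 fun j : Fin n => Complex.exp (2 * Real.pi * Complex.I / n) ^ (j : ℕ))
    (Fin.cons_injective_iff.mpr ⟨by simp [Complex.exp_ne_zero],
      fun i j hij => Fin.ext (hω.pow_inj i.2 j.2 hij)⟩)
    (Equiv.Perm.decomposeFin.symm (0, finRotate n)) (Real.pi / n) fun j => by
      refine Fin.cases ?_ (fun j => ?_) j
      · simp
      · rw [Equiv.Perm.decomposeFin_symm_apply_succ, Equiv.swap_self, Equiv.refl_apply,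
          Fin.cons_succ, Fin.cons_succ, pow_finRotate hω.pow_eq_one]
        congr 2
        push_cast
        ring
  refine ⟨t, ζ, ?_, ht⟩
  rw [hζ, ← Complex.exp_nat_mul, neg_eq_neg_one_mul (Complex.exp _),
    ← Complex.exp_neg_pi_mul_I, ← Complex.exp_add]
  congr 1
  push_cast
  field_simp
  ring

end Rotation

section Connected

variable {n : ℕ} [Fact (2 ≤ n + 1)] [NeZero n]

theorem Joined.smul_formSpace {t t' : FormSpace n} (h : Joined t t')
    (ζ : rootsOfUnity (2 * n) ℂ) : Joined (ζ • t) (ζ • t') :=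
  h.map (isQuotientCoveringMap_formRoots.continuous_const_smul ζ)

theorem exists_joined_smul_formSpace (t t' : FormSpace n) :
    ∃ ξ : rootsOfUnity (2 * n) ℂ, Joined t' (ξ • t) := by
  obtain ⟨γ⟩ := PathConnectedSpace.joined (formRoots t') (formRoots t)
  have cov := (isQuotientCoveringMap_formRoots (n := n)).isCoveringMap
  have hl := cov.liftPath_lifts γ t' γ.source
  have h1 : formRoots (cov.liftPath γ t' γ.source 1) = formRoots t :=
    (congrFun hl 1).trans γ.target
  obtain ⟨ξ, hξ⟩ := formRoots_eq_iff.mp h1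
  exact ⟨ξ, ⟨⟨cov.liftPath γ t' γ.source, cov.liftPath_zero _ _ _, hξ.symm⟩⟩⟩

/-- The deck transformations preserving the path components of the space of forms. -/
def joinedSubgroup (n : ℕ) [Fact (2 ≤ n + 1)] [NeZero n] : Subgroup (rootsOfUnity (2 * n) ℂ) where
  carrier := {ζ | ∀ t : FormSpace n, Joined t (ζ • t)}
  one_mem' t := by rw [one_smul]
  mul_mem' {ζ ξ} hζ hξ t := by
    rw [mul_smul]
    exact (hξ t).trans (hζ _)
  inv_mem' {ζ} hζ t := by
    have := (hζ (ζ⁻¹ • t)).symm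
    rwa [smul_inv_smul] at this

theorem mem_joinedSubgroup_of_joined {t : FormSpace n} {ζ : rootsOfUnity (2 * n) ℂ}
    (h : Joined t (ζ • t)) : ζ ∈ joinedSubgroup n := by
  intro t'
  obtain ⟨ξ, hξ⟩ := exists_joined_smul_formSpace t t'
  refine hξ.trans ((h.smul_formSpace ξ).trans ?_)
  rw [smul_smul, mul_comm ξ ζ, ← smul_smul]
  exact (hξ.smul_formSpace ζ).symm

theorem joinedSubgroup_eq_top : joinedSubgroup n = ⊤ := by
  obtain ⟨_, ζ, hζ, h⟩ := exists_joined_neg_one (n := n)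
  obtain ⟨_, ξ, hξ, h'⟩ := exists_joined_exp (n := n)
  have hmem := mul_mem (mem_joinedSubgroup_of_joined h)
    (inv_mem (mem_joinedSubgroup_of_joined h'))
  have h2n : 2 * n ≠ 0 := by have := NeZero.ne n; omega
  have hval : (((ζ * ξ⁻¹ : rootsOfUnity (2 * n) ℂ) : ℂˣ) : ℂ) =
      Complex.exp (2 * Real.pi * Complex.I / (2 * n : ℕ)) := by
    have hn : (n : ℂ) ≠ 0 := Nat.cast_ne_zero.mpr (NeZero.ne n)
    simp only [Subgroup.coe_mul, InvMemClass.coe_inv, Units.val_mul, Units.val_inv_eq_inv_val,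
      hζ, hξ, Complex.exp_neg, inv_neg, inv_inv, neg_mul_neg, one_mul]
    congr 1
    push_cast
    field_simp
  have hprim : IsPrimitiveRoot (((ζ * ξ⁻¹ : rootsOfUnity (2 * n) ℂ) : ℂˣ) : ℂ) (2 * n) :=
    hval ▸ Complex.isPrimitiveRoot_exp _ h2n
  refine eq_top_iff.mpr fun χ _ => ?_
  obtain ⟨i, -, hi⟩ := hprim.eq_pow_of_pow_eq_one (ξ := ((χ : ℂˣ) : ℂ)) (by
    rw [← Units.val_pow_eq_pow_val, (mem_rootsOfUnity _ _).mp χ.2, Units.val_one])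
  have : χ = (ζ * ξ⁻¹) ^ i := Subtype.ext (Units.ext (by simpa using hi.symm))
  exact this ▸ pow_mem hmem i

instance pathConnectedSpace_formSpace : PathConnectedSpace (FormSpace n) where
  nonempty := let ⟨t, _⟩ := exists_joined_neg_one (n := n); ⟨t⟩
  joined t t' := by
    obtain ⟨ξ, hξ⟩ := exists_joined_smul_formSpace t' t
    have : ξ ∈ joinedSubgroup n := by
      rw [joinedSubgroup_eq_top]
      exact Subgroup.mem_top ξ
    exact hξ.trans (this t').symm

theorem exists_surjective_rootsOfUnity (b : Cconf (n + 1) 1 1) :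
    ∃ f : Abelianization (FundamentalGroup (Cconf (n + 1) 1 1) b) →* (rootsOfUnity (2 * n) ℂ)ᵐᵒᵖ,
      Function.Surjective f := by
  have hp := isQuotientCoveringMap_formRoots (n := n)
  obtain ⟨t, ht⟩ := hp.surjective b
  let e : formRoots (n := n) ⁻¹' {b} := ⟨t, ht⟩
  refine ⟨Abelianization.lift (hp.fundamentalGroupToMulOpposite e), fun g => ?_⟩
  obtain ⟨γ, hγ⟩ := hp.fundamentalGroupToMulOpposite_surjective e g
  exact ⟨Abelianization.of γ, by rw [Abelianization.lift_apply_of, hγ]⟩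

end Connected

theorem nonempty_addEquiv_zmod_of_generator {A B : Type*} [CommGroup A] [Group B] {m : ℕ}
    [NeZero m] (hB : Nat.card B = m) {f : A →* B} (hf : Function.Surjective f) {s : A}
    (hs : s ^ m = 1) (hgen : ∀ a, a ∈ Subgroup.zpowers s) :
    Nonempty (Additive A ≃+ ZMod m) := by
  have hcyc : IsCyclic A := ⟨s, hgen⟩
  have hord : orderOf s = Nat.card A := orderOf_eq_card_of_forall_mem_zpowers hgen
  have hdvd : Nat.card A ∣ m := hord ▸ orderOf_dvd_of_pow_eq_one hs
  have hfin : Finite A := Nat.finite_of_card_ne_zero (ne_zero_of_dvd_ne_zero (NeZero.ne m) hdvd)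
  have hcard : Nat.card A = m := le_antisymm (Nat.le_of_dvd (NeZero.pos m) hdvd)
    (hB ▸ Nat.card_le_card_of_surjective f hf)
  subst hcard
  exact ⟨(zmodAddCyclicAddEquiv (G := Additive A) inferInstance).symm⟩

/-- For `k ≥ 2`, the abelianization of `π₁(C_{k+1}^{1,1})` (the first homology group of
this path-connected space) is the cyclic group `ℤ/2kℤ`. -/
theorem H1_Cconf_one_one (k : ℕ) (hk : 2 ≤ k) (x : Cconf (k + 1) 1 1) :
    Nonempty (Additive (Abelianization (FundamentalGroup (Cconf (k + 1) 1 1) x)) ≃+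
      ZMod (2 * k)) := by
  have : NeZero k := ⟨by omega⟩
  have : Fact (2 ≤ k + 1) := ⟨by omega⟩
  have : NeZero (2 * k) := ⟨by omega⟩
  obtain ⟨s, hs, hgen⟩ := exists_generator x
  obtain ⟨f, hf⟩ := exists_surjective_rootsOfUnity x
  refine nonempty_addEquiv_zmod_of_generator ?_ hf hs hgen
  rw [Nat.card_congr MulOpposite.opEquiv.symm, Complex.card_rootsOfUnity]
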